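/- arXiv:2109.07718 — 6 statements merged into one kernel-verified Lean document; each statement's English description precedes it below -/
import Mathlib

section
/- The function f(x) = x^{0.3} − x^{0.14}·(x^{0.2} − 1)^{0.8} is strictly monotonically increasing on the interval [2, ∞) of real numbers. -/
theorem key_ineq (b c : ℝ) (hc : 0 < c) (h1 : 0.6 * c ≤ b) (h2 : b < c) :
    0.7 * b ^ 5 + 0.8 * c ^ 5 < 1.5 * c ^ 4 * b := by
  have hb : 0 < b := by linarith
  have e : 1.5 * c ^ 4 * b - (0.7 * b ^ 5 + 0.8 * c ^ 5)
      = (c - b) * (0.7 * (b * c ^ 3 + b ^ 2 * c ^ 2 + b ^ 3 * c + b ^ 4) - 0.8 * c ^ 4) := by ring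
  have h0 : (0:ℝ) ≤ 0.6 * c := by positivity
  have p2 := pow_le_pow_left₀ h0 h1 2
  have p3 := pow_le_pow_left₀ h0 h1 3
  have p4 := pow_le_pow_left₀ h0 h1 4
  have q1 := mul_le_mul_of_nonneg_right h1 (by positivity : 0 ≤ c ^ 3)
  have q2 := mul_le_mul_of_nonneg_right p2 (by positivity : 0 ≤ c ^ 2)
  have q3 := mul_le_mul_of_nonneg_right p3 hc.le
  have c4 : 0 < c ^ 4 := by positivity
  have : 0 < 0.7 * (b * c ^ 3 + b ^ 2 * c ^ 2 + b ^ 3 * c + b ^ 4) - 0.8 * c ^ 4 := by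
    ring_nf at q1 q2 q3 p4 ⊢
    linarith
  have := mul_pos (sub_pos.2 h2) this
  linarith

theorem deriv_ineq (u : ℝ) (hu : 1.1 < u) :
    0 < 1.5 * u ^ ((1.5:ℝ) - 1) - (0.7 * u ^ ((0.7:ℝ) - 1) * (u - 1) ^ (0.8:ℝ)
      + u ^ (0.7:ℝ) * (0.8 * (u - 1) ^ ((0.8:ℝ) - 1))) := by
  have hu0 : 0 < u := by linarith
  have hv0 : 0 < u - 1 := by linarith
  obtain ⟨a, ha⟩ : ∃ a, a = u ^ (0.1:ℝ) := ⟨_, rfl⟩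
  obtain ⟨b, hb⟩ : ∃ b, b = (u - 1) ^ (0.2:ℝ) := ⟨_, rfl⟩
  have a0 : 0 < a := ha ▸ Real.rpow_pos_of_pos hu0 _
  have b0 : 0 < b := hb ▸ Real.rpow_pos_of_pos hv0 _
  have ea (n : ℕ) : a ^ n = u ^ (0.1 * n : ℝ) := by
    rw [ha, Real.rpow_mul_natCast hu0.le]
  have eb (n : ℕ) : b ^ n = (u - 1) ^ (0.2 * n : ℝ) := by
    rw [hb, Real.rpow_mul_natCast hv0.le]
  have e1 : u ^ ((1.5:ℝ) - 1) = a ^ 5 := by rw [ea]; norm_num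
  have e2 : u ^ ((0.7:ℝ) - 1) = (a ^ 3)⁻¹ := by rw [ea, ← Real.rpow_neg hu0.le]; norm_num
  have e3 : u ^ (0.7:ℝ) = a ^ 7 := by rw [ea]; norm_num
  have e4 : (u - 1) ^ (0.8:ℝ) = b ^ 4 := by rw [eb]; norm_num
  have e5 : (u - 1) ^ ((0.8:ℝ) - 1) = b⁻¹ := by rw [hb, ← Real.rpow_neg hv0.le]; norm_num
  have e6 : a ^ 10 = u := by rw [ea]; norm_num
  have e7 : b ^ 5 = u - 1 := by rw [eb]; norm_num
  rw [e1, e2, e3, e4, e5]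
  have h1 : 0.6 * a ^ 2 ≤ b := by
    refine le_of_pow_le_pow_left₀ (n := 5) (by norm_num) b0.le ?_
    have : (0.6 * a ^ 2) ^ 5 = 0.6 ^ 5 * a ^ 10 := by ring
    rw [this, e6, e7]; norm_num at hu ⊢; linarith
  have h2 : b < a ^ 2 := by
    refine lt_of_pow_lt_pow_left₀ 5 (by positivity) ?_
    have : (a ^ 2) ^ 5 = a ^ 10 := by ring
    rw [this, e6, e7]; linarith
  have k := key_ineq b (a ^ 2) (by positivity) h1 h2
  have : 1.5 * a ^ 5 - (0.7 * (a ^ 3)⁻¹ * b ^ 4 + a ^ 7 * (0.8 * b⁻¹))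
     = (1.5 * (a ^ 2) ^ 4 * b - (0.7 * b ^ 5 + 0.8 * (a ^ 2) ^ 5)) / (a ^ 3 * b) := by
    field_simp
  rw [this]
  exact div_pos (by linarith) (by positivity)

theorem h_mono : StrictMonoOn (fun u : ℝ => u ^ (1.5:ℝ) - u ^ (0.7:ℝ) * (u - 1) ^ (0.8:ℝ))
    (Set.Ici (1.1:ℝ)) := by
  have hd : ∀ u : ℝ, 1.1 ≤ u → HasDerivAt
      (fun u : ℝ => u ^ (1.5:ℝ) - u ^ (0.7:ℝ) * (u - 1) ^ (0.8:ℝ))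
      (1.5 * u ^ ((1.5:ℝ) - 1) - (0.7 * u ^ ((0.7:ℝ) - 1) * (u - 1) ^ (0.8:ℝ)
      + u ^ (0.7:ℝ) * (0.8 * (u - 1) ^ ((0.8:ℝ) - 1)))) u := by
    intro u hu
    have hu0 : u ≠ 0 := by intro h; norm_num [h] at hu
    have hv0 : u - 1 ≠ 0 := by intro h; rw [sub_eq_zero.1 h] at hu; norm_num at hu
    have d1 := Real.hasDerivAt_rpow_const (x := u) (p := 1.5) (Or.inl hu0)
    have d2 := Real.hasDerivAt_rpow_const (x := u) (p := 0.7) (Or.inl hu0)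
    have d3 := (Real.hasDerivAt_rpow_const (x := u - 1) (p := 0.8) (Or.inl hv0)).comp_sub_const u 1
    exact d1.sub (d2.mul d3)
  refine strictMonoOn_of_deriv_pos (convex_Ici _)
    (fun u hu => (hd u hu).continuousAt.continuousWithinAt) ?_
  intro u hu
  rw [interior_Ici] at hu
  rw [(hd u (le_of_lt hu)).deriv]
  exact deriv_ineq u hu

theorem f_strictMonoOn :
    StrictMonoOn (fun x : ℝ => x ^ (0.3 : ℝ) - x ^ (0.14 : ℝ) * (x ^ (0.2 : ℝ) - 1) ^ (0.8 : ℝ))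
      (Set.Ici (2 : ℝ)) := by
  have low : ∀ x : ℝ, 2 ≤ x → 1.1 ≤ x ^ (0.2:ℝ) := by
    intro x hx
    have hx0 : 0 ≤ x := by linarith
    refine le_of_pow_le_pow_left₀ (n := 5) (by norm_num) (Real.rpow_nonneg hx0 _) ?_
    rw [← Real.rpow_mul_natCast hx0]
    norm_num
    linarith
  intro x hx y hy hxy
  have hx : 2 ≤ x := hx
  have hy : 2 ≤ y := hy
  have hx0 : 0 ≤ x := by linarith
  have hy0 : 0 ≤ y := by linarith
  have := h_mono (low x hx) (low y hy) (Real.rpow_lt_rpow hx0 hxy (by norm_num))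
  simp only [← Real.rpow_mul hx0, ← Real.rpow_mul hy0] at this
  have n1 : (0.2:ℝ) * 1.5 = 0.3 := by norm_num
  have n2 : (0.2:ℝ) * 0.7 = 0.14 := by norm_num
  rw [n1, n2] at this
  exact this
end

section
/- For every real number x ≥ 2, x^{0.3} − x^{0.14}·(x^{0.2} − 1)^{0.8} ≥ 0.98. -/
lemma poly_aux (v : ℝ) (h : 0.66 ≤ v) (h1 : v ≤ 1) :
    0.9604 * (1 - v^5)^3 ≤ (1 - v^4)^2 := by
  have key : 0 ≤ (1+v+v^2+v^3)^2 - 0.9604*(1-v)*(1+v+v^2+v^3+v^4)^3 := by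
    obtain ⟨s, rfl⟩ : ∃ s, v = 0.66 + s := ⟨v - 0.66, by ring⟩
    have hs : 0 ≤ s := by linarith
    ring_nf
    positivity
  have h2 := mul_nonneg (sq_nonneg (1 - v)) key
  nlinarith [h2]

theorem f_ge_098 (x : ℝ) (hx : 2 ≤ x) :
    x ^ (0.3 : ℝ) - x ^ (0.14 : ℝ) * (x ^ (0.2 : ℝ) - 1) ^ (0.8 : ℝ) ≥ 0.98 := by
  have hx0 : 0 ≤ x := by linarith
  obtain ⟨t, ht⟩ : ∃ t, t = x ^ (0.02 : ℝ) := ⟨_, rfl⟩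
  have ht0 : 0 < t := by rw [ht]; positivity
  have e1 : x ^ (0.3 : ℝ) = t ^ 15 := by
    rw [ht, ← Real.rpow_natCast, ← Real.rpow_mul hx0]; norm_num
  have e2 : x ^ (0.14 : ℝ) = t ^ 7 := by
    rw [ht, ← Real.rpow_natCast, ← Real.rpow_mul hx0]; norm_num
  have e3 : x ^ (0.2 : ℝ) = t ^ 10 := by
    rw [ht, ← Real.rpow_natCast, ← Real.rpow_mul hx0]; norm_num
  have e4 : x = (t ^ 10) ^ 5 := by
    rw [← pow_mul, ht, ← Real.rpow_natCast, ← Real.rpow_mul hx0]; norm_num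
  have hy : 1.1432 ≤ t ^ 10 := by
    by_contra hc
    push Not at hc
    have : (t^10)^5 < 1.1432^5 := by gcongr
    norm_num at this
    norm_num at *
    linarith
  rw [e1, e2, e3]
  have hy1 : 0 ≤ t ^ 10 - 1 := by linarith
  obtain ⟨w, hw⟩ : ∃ w, w = (t ^ 10 - 1) ^ (0.2 : ℝ) := ⟨_, rfl⟩
  have hw0 : 0 ≤ w := by rw [hw]; positivity
  have e5 : (t ^ 10 - 1) ^ (0.8 : ℝ) = w ^ 4 := by
    rw [hw, ← Real.rpow_mul_natCast hy1]; norm_num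
  have e6 : w ^ 5 = t ^ 10 - 1 := by
    rw [hw, ← Real.rpow_mul_natCast hy1]; norm_num
  rw [e5]
  obtain ⟨v, hv⟩ : ∃ v, w = v * t ^ 2 := ⟨w / t ^ 2, by field_simp⟩
  have hv0 : 0 ≤ v := by
    by_contra hc
    push Not at hc
    have := mul_neg_of_neg_of_pos hc (pow_pos ht0 2)
    linarith
  have e7 : t ^ 10 * (1 - v ^ 5) = 1 := by
    rw [hv] at e6
    linear_combination -e6
  have hv5 : v ^ 5 < 1 := by
    by_contra hc
    push Not at hc
    nlinarith
  have hv1 : v ≤ 1 := by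
    by_contra hc
    push Not at hc
    have : 1 < v ^ 5 := one_lt_pow₀ hc (by norm_num)
    linarith
  have hv2 : 0.66 ≤ v := by
    by_contra hc
    push Not at hc
    have : v ^ 5 < 0.66 ^ 5 := by gcongr
    nlinarith
  have hp := poly_aux v hv2 hv1
  have e8 : t ^ 30 * (1 - v ^ 5) ^ 3 = 1 := by
    have : t ^ 30 * (1 - v ^ 5) ^ 3 = (t ^ 10 * (1 - v ^ 5)) ^ 3 := by ring
    rw [this, e7]; norm_num
  have h9 : (0.98 : ℝ) ^ 2 ≤ (t ^ 15 * (1 - v ^ 4)) ^ 2 := by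
    have := mul_le_mul_of_nonneg_left hp (pow_pos ht0 30).le
    have e : t ^ 30 * (0.9604 * (1 - v ^ 5) ^ 3) = 0.9604 := by
      linear_combination 0.9604 * e8
    rw [e] at this
    calc (0.98 : ℝ) ^ 2 = 0.9604 := by norm_num
      _ ≤ _ := this
      _ = _ := by ring
  have h10 : 0 ≤ t ^ 15 * (1 - v ^ 4) :=
    mul_nonneg (pow_pos ht0 15).le (by linarith [pow_le_one₀ hv0 hv1 (n := 4)])
  have h11 := (sq_le_sq₀ (by norm_num) h10).1 h9
  rw [hv]
  have : t ^ 15 - t ^ 7 * (v * t ^ 2) ^ 4 = t ^ 15 * (1 - v ^ 4) := by ring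
  rw [this]
  exact h11
end

section
/- For every real number x ≥ 2, 3x − 6 + 100·x^{1.14}·(x^{0.2} − 1)^{0.8} ≤ 100·x^{1.3} − 1. -/
theorem ineq_case2 (x : ℝ) (hx : 2 ≤ x) :
    3 * x - 6 + 100 * x ^ (1.14 : ℝ) * (x ^ (0.2 : ℝ) - 1) ^ (0.8 : ℝ)
      ≤ 100 * x ^ (1.3 : ℝ) - 1 := by
  have hx0 : 0 < x := by linarith
  have ht1 : 1 ≤ x ^ (0.2 : ℝ) := Real.one_le_rpow (by linarith) (by norm_num)
  have hinv : x ^ (-0.2 : ℝ) ≤ 1 := Real.rpow_le_one_of_one_le_of_nonpos (by linarith) (by norm_num)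
  have hfac : x ^ (0.2 : ℝ) - 1 = x ^ (0.2 : ℝ) * (1 + -x ^ (-0.2 : ℝ)) := by
    have : x ^ (0.2 : ℝ) * x ^ (-0.2 : ℝ) = 1 := by
      rw [← Real.rpow_add hx0]; norm_num
    linarith
  have hb : (1 + -x ^ (-0.2 : ℝ)) ^ (0.8 : ℝ) ≤ 1 + 0.8 * -x ^ (-0.2 : ℝ) :=
    rpow_one_add_le_one_add_mul_self (by linarith) (by norm_num) (by norm_num)
  have hpow : (x ^ (0.2 : ℝ) - 1) ^ (0.8 : ℝ)
      = x ^ (0.16 : ℝ) * (1 + -x ^ (-0.2 : ℝ)) ^ (0.8 : ℝ) := by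
    rw [hfac, Real.mul_rpow (by linarith) (by linarith), ← Real.rpow_mul hx0.le]
    norm_num
  have h13 : x ^ (1.14 : ℝ) * x ^ (0.16 : ℝ) = x ^ (1.3 : ℝ) := by
    rw [← Real.rpow_add hx0]; norm_num
  have h11 : x ^ (1.3 : ℝ) * x ^ (-0.2 : ℝ) = x ^ (1.1 : ℝ) := by
    rw [← Real.rpow_add hx0]; norm_num
  have hxx : x ≤ x ^ (1.1 : ℝ) := Real.self_le_rpow_of_one_le (by linarith) (by norm_num)
  have hm := mul_le_mul_of_nonneg_left hb (Real.rpow_nonneg hx0.le (1.3 : ℝ))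
  have he : 100 * x ^ (1.14 : ℝ) * (x ^ (0.2 : ℝ) - 1) ^ (0.8 : ℝ)
      = 100 * (x ^ (1.3 : ℝ) * (1 + -x ^ (-0.2 : ℝ)) ^ (0.8 : ℝ)) := by
    rw [hpow, ← h13]; ring
  have hr : x ^ (1.3 : ℝ) * (1 + 0.8 * -x ^ (-0.2 : ℝ)) = x ^ (1.3 : ℝ) - 0.8 * x ^ (1.1 : ℝ) := by
    rw [← h11]; ring
  rw [hr] at hm
  rw [he]
  linarith
end

section
/- Let n ≥ 2 be an integer and let (R,B) be a red–blue coloring of the edges of the complete graph K_N such that the graph formed by the blue edges contains no 3-element irredundant set and the graph formed by the red edges contains no n-element independent set. Then every vertex has at most n − 1 red neighbors and at most t(3, n−1) − 1 blue neighbors. -/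
/-- A set `X` of vertices is irredundant in `G` if every `x ∈ X` is either isolated in the
induced subgraph on `X`, or has a private neighbor `y ∉ X` adjacent to `x` and to no other
vertex of `X`. -/
def SimpleGraph.IsIrredundant {V : Type*} (G : SimpleGraph V) (X : Finset V) : Prop :=
  ∀ x ∈ X, (∀ y ∈ X, ¬ G.Adj x y) ∨
    ∃ y, y ∉ X ∧ G.Adj x y ∧ ∀ z ∈ X, z ≠ x → ¬ G.Adj z y

/-- A set `X` of vertices is independent in `G` if no two of its vertices are adjacent. -/
def SimpleGraph.IsIndependent {V : Type*} (G : SimpleGraph V) (X : Finset V) : Prop :=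
  ∀ x ∈ X, ∀ y ∈ X, ¬ G.Adj x y

/-- The mixed Ramsey number `t(m,n)`: the smallest `N` such that for every red-blue coloring
of the edges of `K_N` (the red graph being `G`, the blue graph its complement `Gᶜ`), the blue
graph contains an `m`-element irredundant set or the red graph contains an `n`-element
independent set. -/
noncomputable def mixedRamsey (m n : ℕ) : ℕ :=
  sInf {N : ℕ | ∀ G : SimpleGraph (Fin N),
    (∃ X : Finset (Fin N), X.card = m ∧ Gᶜ.IsIrredundant X) ∨
    (∃ X : Finset (Fin N), X.card = n ∧ G.IsIndependent X)}

/-- The irredundant Ramsey number `s(m,n)`: the smallest `N` such that for every red-blue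
coloring of the edges of `K_N` (red graph `G`, blue graph `Gᶜ`), the blue graph contains an
`m`-element irredundant set or the red graph contains an `n`-element irredundant set. -/
noncomputable def irredundantRamsey (m n : ℕ) : ℕ :=
  sInf {N : ℕ | ∀ G : SimpleGraph (Fin N),
    (∃ X : Finset (Fin N), X.card = m ∧ Gᶜ.IsIrredundant X) ∨
    (∃ X : Finset (Fin N), X.card = n ∧ G.IsIrredundant X)}

/-- The Ramsey number `r(m,n)`: the smallest `N` such that for every red-blue coloring of the
edges of `K_N` (red graph `G`, blue graph `Gᶜ`), the blue graph contains an `m`-element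
independent set or the red graph contains an `n`-element independent set. -/
noncomputable def ramsey (m n : ℕ) : ℕ :=
  sInf {N : ℕ | ∀ G : SimpleGraph (Fin N),
    (∃ X : Finset (Fin N), X.card = m ∧ Gᶜ.IsIndependent X) ∨
    (∃ X : Finset (Fin N), X.card = n ∧ G.IsIndependent X)}

lemma indep_subset {V : Type*} {G : SimpleGraph V} {X Y : Finset V} (h : X ⊆ Y)
    (hY : G.IsIndependent Y) : G.IsIndependent X :=
  fun x hx y hy => hY x (h hx) y (h hy)

lemma no_tri {V : Type*} {G : SimpleGraph V}
    (hb : ¬ ∃ X : Finset V, X.card = 3 ∧ Gᶜ.IsIrredundant X) (a b c : V)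
    (h1 : G.Adj a b) (h2 : G.Adj a c) : ¬ G.Adj b c := by
  classical
  intro h3
  apply hb
  refine ⟨{a, b, c}, Finset.card_eq_three.2 ⟨a, b, c, h1.ne, h2.ne, h3.ne, rfl⟩, ?_⟩
  intro x hx
  left
  intro y hy
  simp only [Finset.mem_insert, Finset.mem_singleton] at hx hy
  rw [SimpleGraph.compl_adj]
  rintro ⟨hne, hn⟩
  have h1' := h1.symm
  have h2' := h2.symm
  have h3' := h3.symm
  rcases hx with rfl | rfl | rfl <;> rcases hy with rfl | rfl | rfl <;> first | exact hne rfl | exact hn (by assumption)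

lemma ind_insert {V : Type*} [DecidableEq V] {G : SimpleGraph V} {X : Finset V} {v : V}
    (hX : G.IsIndependent X) (hv : ∀ x ∈ X, ¬ G.Adj v x) : G.IsIndependent (insert v X) := by
  intro x hx y hy
  rw [Finset.mem_insert] at hx hy
  rcases hx with rfl | hx <;> rcases hy with rfl | hy
  · exact G.irrefl
  · exact hv y hy
  · exact fun h => hv x hx h.symm
  · exact hX x hx y hy

lemma ramsey3 {V : Type*} (G : SimpleGraph V)
    (hb : ¬ ∃ X : Finset V, X.card = 3 ∧ Gᶜ.IsIrredundant X) (k : ℕ) :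
    ∀ S : Finset V, k ^ 2 ≤ S.card → ∃ X ⊆ S, X.card = k ∧ G.IsIndependent X := by
  classical
  induction k with
  | zero => exact fun S _ => ⟨∅, by simp, by simp, fun x hx => by simp at hx⟩
  | succ k ih =>
    intro S hS
    obtain ⟨v, hv⟩ : S.Nonempty := by
      exact Finset.card_pos.1 (lt_of_lt_of_le (by positivity) hS)
    have hc := Finset.card_filter_add_card_filter_not (s := S.erase v) (fun x => G.Adj v x)
    rw [Finset.card_erase_of_mem hv] at hc
    by_cases h : k + 1 ≤ ((S.erase v).filter (fun x => G.Adj v x)).card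
    · obtain ⟨X, hX, hXc⟩ := Finset.exists_subset_card_eq h
      refine ⟨X, fun x hx => Finset.mem_of_mem_erase (Finset.mem_filter.1 (hX hx)).1, hXc, ?_⟩
      intro x hx y hy
      exact no_tri hb v x y (Finset.mem_filter.1 (hX hx)).2 (Finset.mem_filter.1 (hX hy)).2
    · obtain ⟨X, hX, hXc, hXi⟩ := ih ((S.erase v).filter (fun x => ¬ G.Adj v x)) (by
        have : (k + 1) ^ 2 = k ^ 2 + 2 * k + 1 := by ring
        omega)
      refine ⟨insert v X, ?_, ?_, ind_insert hXi fun x hx => (Finset.mem_filter.1 (hX hx)).2⟩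
      · intro x hx
        rcases Finset.mem_insert.1 hx with rfl | hx
        · exact hv
        · exact Finset.mem_of_mem_erase (Finset.mem_filter.1 (hX hx)).1
      · rw [Finset.card_insert_of_notMem, hXc]
        intro h'
        simpa using hX h'

lemma mixed_mem (k : ℕ) (G : SimpleGraph (Fin (mixedRamsey 3 k))) :
    (∃ X : Finset (Fin (mixedRamsey 3 k)), X.card = 3 ∧ Gᶜ.IsIrredundant X) ∨
    (∃ X : Finset (Fin (mixedRamsey 3 k)), X.card = k ∧ G.IsIndependent X) := by
  have h : mixedRamsey 3 k ∈ {N : ℕ | ∀ G : SimpleGraph (Fin N),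
      (∃ X : Finset (Fin N), X.card = 3 ∧ Gᶜ.IsIrredundant X) ∨
      (∃ X : Finset (Fin N), X.card = k ∧ G.IsIndependent X)} := by
    refine Nat.sInf_mem ⟨k ^ 2, fun G => ?_⟩
    by_cases hb : ∃ X : Finset (Fin (k ^ 2)), X.card = 3 ∧ Gᶜ.IsIrredundant X
    · exact Or.inl hb
    · obtain ⟨X, -, h⟩ := ramsey3 G hb k Finset.univ (by simp)
      exact Or.inr ⟨X, h⟩
  exact h G

theorem degree_bounds_in_good_coloring (n N : ℕ) (hn : 2 ≤ n)
    (G : SimpleGraph (Fin N)) [DecidableRel G.Adj]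
    (hblue : ¬ ∃ X : Finset (Fin N), X.card = 3 ∧ Gᶜ.IsIrredundant X)
    (hred : ¬ ∃ X : Finset (Fin N), X.card = n ∧ G.IsIndependent X) :
    ∀ v : Fin N, G.degree v ≤ n - 1 ∧ Gᶜ.degree v ≤ mixedRamsey 3 (n - 1) - 1 := by
  intro v
  constructor
  · by_contra hlt
    have h : n ≤ (G.neighborFinset v).card := by
      rw [SimpleGraph.card_neighborFinset_eq_degree]; omega
    obtain ⟨X, hX, hXc⟩ := Finset.exists_subset_card_eq h
    refine hred ⟨X, hXc, fun x hx y hy => no_tri hblue v x y ?_ ?_⟩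
    · simpa using hX hx
    · simpa using hX hy
  · by_contra hlt
    have h : mixedRamsey 3 (n - 1) ≤ (Gᶜ.neighborFinset v).card := by
      rw [SimpleGraph.card_neighborFinset_eq_degree]; omega
    obtain ⟨W, hW, hWc⟩ := Finset.exists_subset_card_eq h
    let f : Fin (mixedRamsey 3 (n - 1)) ↪ Fin N := (W.orderEmbOfFin hWc).toEmbedding
    have hf : ∀ i, Gᶜ.Adj v (f i) := fun i => by
      have := hW (W.orderEmbOfFin_mem hWc i)
      rwa [SimpleGraph.mem_neighborFinset] at this
    rcases mixed_mem (n - 1) (G.comap f) with ⟨X, hXc, hX⟩ | ⟨X, hXc, hX⟩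
    · refine hblue ⟨X.map f, by simpa using hXc, ?_⟩
      have hadj : ∀ i j, Gᶜ.Adj (f i) (f j) ↔ (G.comap f)ᶜ.Adj i j := fun i j => by
        simp [SimpleGraph.compl_adj]
      intro x hx
      obtain ⟨i, hi, rfl⟩ := Finset.mem_map.1 hx
      rcases hX i hi with h0 | ⟨j, hj, hij, hp⟩
      · left
        intro y hy
        obtain ⟨j, hj, rfl⟩ := Finset.mem_map.1 hy
        rw [hadj]
        exact h0 j hj
      · right
        refine ⟨f j, by simpa using hj, (hadj _ _).2 hij, ?_⟩
        intro z hz hzi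
        obtain ⟨l, hl, rfl⟩ := Finset.mem_map.1 hz
        rw [hadj]
        exact hp l hl fun e => hzi (by rw [e])
    · refine hred ⟨insert v (X.map f), ?_, ind_insert ?_ ?_⟩
      · rw [Finset.card_insert_of_notMem, Finset.card_map, hXc]
        · omega
        · intro hm
          obtain ⟨i, hi, e⟩ := Finset.mem_map.1 hm
          exact (hf i).ne e.symm
      · intro x hx y hy
        obtain ⟨i, hi, rfl⟩ := Finset.mem_map.1 hx
        obtain ⟨j, hj, rfl⟩ := Finset.mem_map.1 hy
        exact hX i hi j hj
      · intro x hx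
        obtain ⟨i, hi, rfl⟩ := Finset.mem_map.1 hx
        exact ((SimpleGraph.compl_adj _ _ _).1 (hf i)).2
end

section
/- For every integer n ≥ 2, either t(3,n) ≤ 3n − 3, or there exists an integer d with 0 ≤ d ≤ n − 1 such that both t(3,n) ≤ d + t(3, n−1) + 1 and t(3,n) ≤ d + 2n − 5 + t(3, n−d) + 1. -/
namespace T3N

variable {V : Type*}

def NoIrr (G : SimpleGraph V) : Prop := ∀ X : Finset V, X.card = 3 → ¬ Gᶜ.IsIrredundant X

theorem tri {G : SimpleGraph V} (h : NoIrr G) {a b c : V} (hab : G.Adj a b) (hbc : G.Adj b c)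
    (hac : G.Adj a c) : False := by
  classical
  apply h {a, b, c} (Finset.card_eq_three.2 ⟨a, b, c, hab.ne, hac.ne, hbc.ne, rfl⟩)
  intro x hx
  left
  intro y hy
  have h1 := hab.symm
  have h2 := hbc.symm
  have h3 := hac.symm
  simp only [Finset.mem_insert, Finset.mem_singleton] at hx hy
  rw [SimpleGraph.compl_adj]
  rintro ⟨hne, hn⟩
  rcases hx with rfl | rfl | rfl <;> rcases hy with rfl | rfl | rfl <;> simp_all

theorem hex {G : SimpleGraph V} (h : NoIrr G) {a b c d e f : V} (hab : G.Adj a b)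
    (hbc : G.Adj b c) (hcd : G.Adj c d) (hde : G.Adj d e) (hef : G.Adj e f) (hfa : G.Adj f a)
    (had : ¬ G.Adj a d) (hbe : ¬ G.Adj b e) (hcf : ¬ G.Adj c f) : False := by
  classical
  have hac : a ≠ c := by rintro rfl; exact had hcd
  have hae : a ≠ e := by rintro rfl; exact had hde.symm
  have hce : c ≠ e := by rintro rfl; exact hcf hef
  have nad : a ≠ d := by rintro rfl; exact tri h hab hbc hcd.symm
  have nbe : b ≠ e := by rintro rfl; exact tri h hbc hcd hde.symm
  have ncf : c ≠ f := by rintro rfl; exact tri h hcd hde hef.symm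
  apply h {a, c, e} (Finset.card_eq_three.2 ⟨a, c, e, hac, hae, hce, rfl⟩)
  intro x hx
  right
  simp only [Finset.mem_insert, Finset.mem_singleton] at hx ⊢
  rcases hx with rfl | rfl | rfl
  · refine ⟨d, ?_, ?_, ?_⟩
    · rintro (h | h | h)
      exacts [nad h.symm, hcd.ne h.symm, hde.ne h]
    · exact (SimpleGraph.compl_adj _ _ _).2 ⟨nad, had⟩
    · rintro z (rfl | rfl | rfl) hz h'
      exacts [hz rfl, ((SimpleGraph.compl_adj _ _ _).1 h').2 hcd,
        ((SimpleGraph.compl_adj _ _ _).1 h').2 hde.symm]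
  · refine ⟨f, ?_, ?_, ?_⟩
    · rintro (h | h | h)
      exacts [hfa.ne h, ncf h.symm, hef.ne h.symm]
    · exact (SimpleGraph.compl_adj _ _ _).2 ⟨ncf, hcf⟩
    · rintro z (rfl | rfl | rfl) hz h'
      exacts [((SimpleGraph.compl_adj _ _ _).1 h').2 hfa.symm, hz rfl,
        ((SimpleGraph.compl_adj _ _ _).1 h').2 hef]
  · refine ⟨b, ?_, ?_, ?_⟩
    · rintro (h | h | h)
      exacts [hab.ne h.symm, hbc.ne h, nbe h]
    · exact (SimpleGraph.compl_adj _ _ _).2 ⟨nbe.symm, fun h => hbe h.symm⟩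
    · rintro z (rfl | rfl | rfl) hz h'
      exacts [((SimpleGraph.compl_adj _ _ _).1 h').2 hab,
        ((SimpleGraph.compl_adj _ _ _).1 h').2 hbc.symm, hz rfl]

theorem sets_contra {M : ℕ} (hM : Even M) (hM0 : 0 < M) (S : ℕ → Set V)
    (hne : ∀ i, 1 ≤ i → i ≤ M → (S i).Nonempty)
    (h1 : ∀ i, 1 ≤ i → i + 1 ≤ M → ∀ u, u ∈ S i → u ∈ S (i+1) → False)
    (h2 : ∀ i, 1 ≤ i → i + 2 ≤ M → S i ⊆ S (i+2) ∨ S (i+2) ⊆ S i)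
    (h4 : ∀ i, 1 ≤ i → i + 4 ≤ M → ∀ u, u ∈ S i → u ∈ S (i+4) → False)
    (he : S 1 ⊆ S M ∨ S M ⊆ S 1) : False := by
  have key : ∀ i, 1 ≤ i → i + 4 ≤ M → S i ⊆ S (i+2) ∧ S (i+4) ⊆ S (i+2) := by
    intro i hi hi4
    have a := h2 i hi (by omega)
    have b := h2 (i+2) (by omega) (by omega)
    have c := h4 i hi hi4
    obtain ⟨x0, hx0⟩ := hne i hi (by omega)
    obtain ⟨x2, hx2⟩ := hne (i+2) (by omega) (by omega)
    obtain ⟨x4, hx4⟩ := hne (i+4) (by omega) (by omega)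
    rcases a with a | a <;> rcases b with b | b
    · exact (c x0 hx0 (b (a hx0))).elim
    · exact ⟨a, b⟩
    · exact (c x2 (a hx2) (b hx2)).elim
    · exact (c x4 (a (b hx4)) hx4).elim
  by_cases h7 : 7 ≤ M
  · have a := key 1 (by omega) (by omega)
    have b := key 3 (by omega) (by omega)
    obtain ⟨x, hx⟩ := hne 1 le_rfl (by omega)
    exact h4 1 le_rfl (by omega) x hx (b.1 (a.1 hx))
  · obtain ⟨x1, hx1⟩ := hne 1 le_rfl (by omega)
    obtain ⟨x2, hx2⟩ := hne 2 (by omega) (by grind)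
    have : M = 2 ∨ M = 4 ∨ M = 6 := by grind
    rcases this with rfl | rfl | rfl
    · rcases he with he | he
      · exact h1 1 le_rfl le_rfl x1 hx1 (he hx1)
      · exact h1 1 le_rfl le_rfl x2 (he hx2) hx2
    · obtain ⟨x3, hx3⟩ := hne 3 (by omega) (by omega)
      obtain ⟨x4, hx4⟩ := hne 4 (by omega) (by omega)
      have a := h2 1 (by omega) (by omega)
      have b := h2 2 (by omega) (by omega)
      have c1 := h1 1 (by omega) (by omega)
      have c3 := h1 3 (by omega) (by omega)
      rcases he with he | he
      · rcases a with a | a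
        · exact c3 x1 (a hx1) (he hx1)
        · exact c3 x3 hx3 (he (a hx3))
      · rcases b with b | b
        · exact c1 x2 (he (b hx2)) hx2
        · exact c1 x4 (he hx4) (b hx4)
    · obtain ⟨x6, hx6⟩ := hne 6 (by omega) (by omega)
      have a := key 1 (by omega) (by omega)
      have b := key 2 (by omega) (by omega)
      have c3 := h1 3 (by omega) (by omega)
      rcases he with he | he
      · exact c3 x1 (a.1 hx1) (b.2 (he hx1))
      · exact c3 x6 (a.1 (he hx6)) (b.2 hx6)

def CW (G : SimpleGraph V) (U : Set V) (L : ℕ) : Prop :=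
  ∃ f : ℕ → V, f L = f 0 ∧ (∀ i < L, G.Adj (f i) (f (i+1))) ∧ ∀ i ≤ L, f i ∈ U

theorem no_odd {G : SimpleGraph V} (h : NoIrr G) (U : Set V) (v w : V)
    (hv : ∀ x ∈ U, ¬ G.Adj v x)
    (hU : ∀ x ∈ U, x ≠ w → ∃ u, G.Adj v u ∧ G.Adj u x) :
    ∀ L, Odd L → ¬ CW G U L := by
  classical
  by_contra! hc
  have hex' : ∃ L, Odd L ∧ CW G U L := hc
  obtain ⟨hL, f, f0, fa, fU⟩ := Nat.find_spec hex'
  have hmin : ∀ L', L' < Nat.find hex' → Odd L' → ¬ CW G U L' := by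
    intro L' hl ho hcw
    exact Nat.find_min hex' hl ⟨ho, hcw⟩
  generalize Nat.find hex' = L at *
  have hLpos : 0 < L := hL.pos
  -- periodic version, rotated
  obtain ⟨g, gp, ga, gU, gw⟩ : ∃ g : ℕ → V, (∀ i, g (i + L) = g i) ∧
      (∀ i, G.Adj (g i) (g (i+1))) ∧ (∀ i, g i ∈ U) ∧ ∀ i, 0 < i → i < L → g i ≠ w := by
    have Fp : ∀ i, f ((i + L) % L) = f (i % L) := by intro i; simp
    have Fa : ∀ i, G.Adj (f (i % L)) (f ((i+1) % L)) := by
      intro i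
      have hlt := Nat.mod_lt i hLpos
      have := fa _ hlt
      by_cases hh : i % L + 1 < L
      · rw [Nat.add_mod, Nat.mod_eq_of_lt (a := 1) (by omega), Nat.mod_eq_of_lt hh]; exact this
      · have e : i % L + 1 = L := by omega
        have e2 : (i+1) % L = 0 := by
          rw [← Nat.mod_add_mod, e, Nat.mod_self]
        rw [e2, ← f0]
        rw [e] at this
        exact this
    have FU : ∀ i, f (i % L) ∈ U := fun i => fU _ (Nat.mod_lt i hLpos).le
    by_cases hw : ∃ i0, f (i0 % L) = w
    · obtain ⟨i0, hi0⟩ := hw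
      refine ⟨fun i => f ((i0 + i) % L), fun i => by simpa [add_assoc] using Fp (i0 + i), fun i => Fa (i0+i),
        fun i => FU _, ?_⟩
      intro i hi hiL hiw
      rcases Nat.even_or_odd i with hev | hod
      · refine hmin (L - i) (by omega) (by grind) ⟨fun j => f ((i0 + i + j) % L), ?_,
          fun j _ => Fa (i0+i+j), fun j _ => FU _⟩
        have : i0 + i + (L - i) = i0 + L := by omega
        simp only [this, Fp, add_zero]
        rw [hi0]; exact hiw.symm
      · refine hmin i hiL hod ⟨fun j => f ((i0 + j) % L), ?_,
          fun j _ => Fa (i0+j), fun j _ => FU _⟩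
        simp only [add_zero]
        rw [hi0]; exact hiw
    · exact ⟨fun i => f (i % L), Fp, Fa, FU, fun i _ _ hh => hw ⟨i, hh⟩⟩
  have L3 : 3 ≤ L := by
    by_contra hh
    have : L = 1 := by grind
    subst this
    have := ga 0
    rw [gp 0] at this
    exact this.ne rfl
  have chord : ∀ k, ¬ G.Adj (g k) (g (k+3)) := by
    intro k hk
    refine hmin (L-2) (by omega) (by grind)
      ⟨fun j => if j ≤ L - 3 then g (k+3+j) else g (k+3), ?_, ?_, ?_⟩
    · have : ¬ (L - 2 ≤ L - 3) := by omega
      simp [this]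
    · intro i hi
      by_cases h3 : i + 1 ≤ L - 3
      · have : i ≤ L - 3 := by omega
        simp only [this, h3, if_true]
        exact ga (k+3+i)
      · have h4 : i ≤ L - 3 := by omega
        have e : k + 3 + i = k + L := by omega
        simp only [h3, h4, if_true, if_false, e, gp]
        exact hk
    · intro i hi
      dsimp only
      split_ifs <;> exact gU _
  have nest : ∀ x y z, x ∈ U → y ∈ U → z ∈ U → G.Adj x y → G.Adj y z →
      {u | G.Adj v u ∧ G.Adj u x} ⊆ {u | G.Adj v u ∧ G.Adj u z} ∨
      {u | G.Adj v u ∧ G.Adj u z} ⊆ {u | G.Adj v u ∧ G.Adj u x} := by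
    intro x y z hx hy hz hxy hyz
    by_contra! hh
    obtain ⟨h1, h2⟩ := hh
    obtain ⟨a, ⟨ha1, ha2⟩, ha3⟩ := Set.not_subset.1 h1
    obtain ⟨c, ⟨hc1, hc2⟩, hc3⟩ := Set.not_subset.1 h2
    exact hex h ha1 ha2 hxy hyz hc2.symm hc1.symm (hv y hy)
      (fun t => ha3 ⟨ha1, t⟩) (fun t => hc3 ⟨hc1, t.symm⟩)
  have hne : ∀ i, 1 ≤ i → i ≤ L - 1 → ∃ u, G.Adj v u ∧ G.Adj u (g i) := fun i h1 h2 =>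
    hU _ (gU i) (gw i h1 (by omega))
  have n2 : ∀ i, _ := fun i => nest (g i) (g (i+1)) (g (i+2)) (gU _) (gU _) (gU _) (ga i) (ga (i+1))
  refine sets_contra (M := L - 1) (by grind) (by omega)
    (fun i => {u | G.Adj v u ∧ G.Adj u (g i)}) hne ?_ (fun i _ _ => n2 i) ?_ ?_
  · intro i _ _ u hu hu'
    exact tri h hu.2 (ga i) hu'.2
  · intro i hi hi4 a ha ha'
    obtain ⟨b, hb, hb'⟩ : ∃ b, (G.Adj v b ∧ G.Adj b (g (i+1))) ∧ (G.Adj v b ∧ G.Adj b (g (i+3))) := by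
      rcases n2 (i+1) with hs | hs
      · obtain ⟨b, hb⟩ := hne (i+1) (by omega) (by omega)
        exact ⟨b, hb, hs hb⟩
      · obtain ⟨b, hb⟩ := hne (i+3) (by omega) (by omega)
        exact ⟨b, hs hb, hb⟩
    exact hex h ha.2 (ga i) hb.2.symm hb'.2 (ga (i+3)) ha'.2.symm
      (fun t => tri h ha.1 t hb.1) (chord i) (chord (i+1))
  · have h0 : g (L - 1 + 1) = g 0 := by
      have := gp 0
      rw [zero_add] at this
      rw [← this]; congr 1; omega
    have := nest (g 1) (g 0) (g (L-1)) (gU _) (gU _) (gU _) (ga 0).symm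
      (by rw [← h0]; exact (ga (L-1)).symm)
    exact this

theorem bip {G : SimpleGraph V} (h : NoIrr G) (U : Set V) (v w : V)
    (hv : ∀ x ∈ U, ¬ G.Adj v x)
    (hU : ∀ x ∈ U, x ≠ w → ∃ u, G.Adj v u ∧ G.Adj u x) :
    ∃ c : V → Bool, ∀ x ∈ U, ∀ y ∈ U, G.Adj x y → c x ≠ c y := by
  classical
  have h2 : (G.induce U).Colorable 2 := by
    rw [SimpleGraph.two_colorable_iff_forall_loop_even]
    intro u p
    by_contra hp
    rw [Nat.not_even_iff_odd] at hp
    refine no_odd h U v w hv hU _ hp ⟨fun i => (p.getVert i : V), ?_, ?_, ?_⟩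
    · simp
    · intro i hi
      exact p.adj_getVert_succ hi
    · intro i _
      exact (p.getVert i).2
  obtain ⟨C⟩ := h2
  refine ⟨fun x => if hx : x ∈ U then decide (C ⟨x, hx⟩ = 0) else false, ?_⟩
  intro x hx y hy hxy
  have := C.valid (v := ⟨x, hx⟩) (w := ⟨y, hy⟩) hxy
  simp only [hx, hy, dif_pos]
  intro e
  rw [decide_eq_decide] at e
  generalize C ⟨x, hx⟩ = a at *
  generalize C ⟨y, hy⟩ = b at *
  revert a b; decide

def NoInd (G : SimpleGraph V) (W : Finset V) (m : ℕ) : Prop :=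
  ∀ X ⊆ W, X.card = m → ¬ G.IsIndependent X

theorem NoInd.lt {G : SimpleGraph V} {W : Finset V} {m : ℕ} (h : NoInd G W m) {X : Finset V}
    (hX : X ⊆ W) (hi : G.IsIndependent X) : X.card < m := by
  by_contra hh
  obtain ⟨Y, hY, hc⟩ := Finset.exists_subset_card_eq (not_lt.1 hh)
  exact h Y (hY.trans hX) hc fun x hx y hy => hi x (hY hx) y (hY hy)

theorem crude {G : SimpleGraph V} (h : NoIrr G) (m : ℕ) :
    ∀ W : Finset V, NoInd G W m → W.card ≤ m * m := by
  classical
  induction m with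
  | zero =>
    intro W hW
    exact (hW ∅ (by simp) rfl (by intro x hx; simp at hx)).elim
  | succ m ih =>
    intro W hW
    rcases W.eq_empty_or_nonempty with rfl | ⟨v, hv⟩
    · simp
    have h1 : (W.filter (fun x => G.Adj v x)).card < m + 1 := by
      apply hW.lt (Finset.filter_subset _ _)
      intro x hx y hy hxy
      simp only [Finset.mem_filter] at hx hy
      exact tri h hx.2 hxy hy.2
    have h2 : (W.filter (fun x => ¬ G.Adj v x)).card ≤ m * m + 1 := by
      have : ((W.filter (fun x => ¬ G.Adj v x)).erase v).card ≤ m * m := by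
        apply ih
        intro X hX hc hi
        refine hW (insert v X) ?_ ?_ ?_
        · intro x hx
          rw [Finset.mem_insert] at hx
          rcases hx with rfl | hx
          · exact hv
          · have := hX hx
            simp at this; tauto
        · rw [Finset.card_insert_of_notMem, hc]
          intro hvX
          have := hX hvX
          simp at this
        · have key : ∀ x ∈ X, ¬ G.Adj v x := by
            intro x hx
            have := hX hx
            simp at this; tauto
          intro x hx y hy hxy
          rw [Finset.mem_insert] at hx hy
          rcases hx with rfl | hx <;> rcases hy with rfl | hy
          · exact hxy.ne rfl
          · exact key _ hy hxy
          · exact key _ hx hxy.symm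
          · exact hi x hx y hy hxy
      have h3 := Finset.card_erase_of_mem (s := W.filter (fun x => ¬ G.Adj v x)) (a := v) (by simp [hv])
      omega
    have h3 := Finset.card_filter_add_card_filter_not (s := W) (fun x => G.Adj v x)
    nlinarith

theorem good_mem (m : ℕ) : ∃ N, N ∈ {N : ℕ | ∀ G : SimpleGraph (Fin N),
    (∃ X : Finset (Fin N), X.card = 3 ∧ Gᶜ.IsIrredundant X) ∨
    (∃ X : Finset (Fin N), X.card = m ∧ G.IsIndependent X)} := by
  refine ⟨m * m + 1, ?_⟩
  intro G
  by_contra! hh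
  have := crude (G := G) (fun X hX => hh.1 X hX) m Finset.univ (fun X _ hX => hh.2 X hX)
  simp at this

theorem card_lt {G : SimpleGraph V} (h : NoIrr G) {m : ℕ} {W : Finset V} (hW : NoInd G W m) :
    W.card < mixedRamsey 3 m := by
  by_contra hh
  have hmem := Nat.sInf_mem (good_mem m)
  change mixedRamsey 3 m ∈ _ at hmem
  generalize mixedRamsey 3 m = t at *
  obtain ⟨Y, hY, hc⟩ := Finset.exists_subset_card_eq (not_lt.1 hh)
  let e : Fin t ↪ V := (Y.equivFinOfCardEq hc).symm.toEmbedding.trans (Function.Embedding.subtype _)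
  have heY : ∀ i, e i ∈ W := fun i => hY ((Y.equivFinOfCardEq hc).symm i).2
  rcases hmem (G.comap e) with ⟨X, hX, hi⟩ | ⟨X, hX, hi⟩
  · refine h (X.map e) (by simp [hX]) ?_
    intro x hx
    obtain ⟨i, hiX, rfl⟩ := Finset.mem_map.1 hx
    rcases hi i hiX with h1 | ⟨y, hy, h1, h2⟩
    · left
      intro y hy
      obtain ⟨j, hj, rfl⟩ := Finset.mem_map.1 hy
      have := h1 j hj
      simpa [SimpleGraph.compl_adj] using this
    · right
      refine ⟨e y, by simpa using hy, by simpa [SimpleGraph.compl_adj] using h1, ?_⟩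
      intro z hz hzx
      obtain ⟨j, hj, rfl⟩ := Finset.mem_map.1 hz
      have := h2 j hj (fun hh => hzx (by rw [hh]))
      simpa [SimpleGraph.compl_adj] using this
  · refine hW (X.map e) ?_ (by simp [hX]) ?_
    · intro x hx
      obtain ⟨i, hiX, rfl⟩ := Finset.mem_map.1 hx
      exact heY i
    · intro x hx y hy
      obtain ⟨i, hiX, rfl⟩ := Finset.mem_map.1 hx
      obtain ⟨j, hj, rfl⟩ := Finset.mem_map.1 hy
      exact hi i hiX j hj

theorem indep_union {G : SimpleGraph V} [DecidableEq V] {X Y : Finset V} (hX : G.IsIndependent X)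
    (hY : G.IsIndependent Y) (hXY : ∀ x ∈ X, ∀ y ∈ Y, ¬ G.Adj x y) : G.IsIndependent (X ∪ Y) := by
  intro x hx y hy hxy
  rw [Finset.mem_union] at hx hy
  rcases hx with hx | hx <;> rcases hy with hy | hy
  · exact hX x hx y hy hxy
  · exact hXY x hx y hy hxy
  · exact hXY y hy x hx hxy.symm
  · exact hY x hx y hy hxy

theorem indep_single {G : SimpleGraph V} (v : V) : G.IsIndependent {v} := by
  intro x hx y hy hxy
  simp only [Finset.mem_singleton] at hx hy
  subst hx; subst hy
  exact hxy.ne rfl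

theorem core {N n : ℕ} (hn : 2 ≤ n) {G : SimpleGraph (Fin N)} (h : NoIrr G)
    (hI : NoInd G Finset.univ n) (v : Fin N) : N + 4 ≤ 3 * n ∨ ∃ d, d ≤ n - 1 ∧
      N ≤ d + mixedRamsey 3 (n-1) ∧ N + 5 ≤ d + 2 * n + mixedRamsey 3 (n-d) := by
  classical
  set A : Finset (Fin N) := Finset.univ.filter (fun x => G.Adj v x) with hA
  have mA : ∀ x, x ∈ A ↔ G.Adj v x := by simp [hA]
  set B : Finset (Fin N) := Finset.univ.filter
    (fun x => x ≠ v ∧ ¬ G.Adj v x ∧ ∃ u, G.Adj v u ∧ G.Adj u x) with hB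
  have mB : ∀ x, x ∈ B ↔ (x ≠ v ∧ ¬ G.Adj v x ∧ ∃ u, G.Adj v u ∧ G.Adj u x) := by simp [hB]
  set R : Finset (Fin N) := Finset.univ.filter
    (fun x => x ≠ v ∧ ¬ G.Adj v x ∧ ¬ ∃ u, G.Adj v u ∧ G.Adj u x) with hR
  have mR : ∀ x, x ∈ R ↔ (x ≠ v ∧ ¬ G.Adj v x ∧ ¬ ∃ u, G.Adj v u ∧ G.Adj u x) := by simp [hR]
  have dBR : Disjoint B R := by
    rw [Finset.disjoint_left]; intro x; rw [mB, mR]; exact fun h1 h2 => h2.2.2 h1.2.2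
  have dA : Disjoint A (B ∪ R) := by
    rw [Finset.disjoint_left]; intro x; rw [Finset.mem_union, mA, mB, mR]; tauto
  have hvn : v ∉ A ∪ (B ∪ R) := by
    simp only [Finset.mem_union, mA, mB, mR]; simp
  have hall : insert v (A ∪ (B ∪ R)) = Finset.univ := by
    ext x
    simp only [Finset.mem_insert, Finset.mem_union, mA, mB, mR, Finset.mem_univ, iff_true]
    generalize (∃ u, G.Adj v u ∧ G.Adj u x) = P
    tauto
  have hN : N = 1 + A.card + B.card + R.card := by
    have := congrArg Finset.card hall
    rw [Finset.card_insert_of_notMem hvn, Finset.card_union_of_disjoint dA,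
      Finset.card_union_of_disjoint dBR, Finset.card_univ, Fintype.card_fin] at this
    omega
  have iA : G.IsIndependent A := by
    intro x hx y hy hxy
    exact tri h ((mA x).1 hx) hxy ((mA y).1 hy)
  have cA : A.card < n := hI.lt (Finset.subset_univ _) iA
  -- first inequality
  have c1 : (B ∪ R).card < mixedRamsey 3 (n-1) := by
    apply card_lt h
    intro X hX hc hi
    have hvX : v ∉ X := fun hh => hvn (Finset.mem_union_right _ (hX hh))
    have := hI.lt (Finset.subset_univ _) (indep_union (indep_single v) hi (by
      intro x hx y hy
      rw [Finset.mem_singleton] at hx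
      subst hx
      have := hX hy
      rw [Finset.mem_union, mB, mR] at this
      tauto))
    rw [Finset.card_union_of_disjoint (by simpa using hvX), hc, Finset.card_singleton] at this
    omega
  rw [Finset.card_union_of_disjoint dBR] at c1
  have c2 : R.card < mixedRamsey 3 (n - A.card) := by
    apply card_lt h
    intro X hX hc hi
    have := hI.lt (Finset.subset_univ _) (indep_union iA hi (by
      intro x hx y hy hxy
      have := hX hy
      rw [mR] at this
      exact this.2.2 ⟨x, (mA x).1 hx, hxy⟩))
    rw [Finset.card_union_of_disjoint, hc] at this
    · omega
    · exact dA.mono_right (hX.trans Finset.subset_union_right)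
  -- bound for a two-colourable set
  have bb : ∀ w, w = v ∨ w ∈ R → ∀ W : Finset (Fin N), (∀ x ∈ W, x ∈ B ∨ (x = w ∧ x ≠ v)) →
      W.card + 4 ≤ 2 * n := by
    intro w hw W hW
    have hWv : ∀ x ∈ W, x ≠ v ∧ ¬ G.Adj v x := by
      intro x hx
      rcases hW x hx with h1 | ⟨h1, h2⟩
      · rw [mB] at h1; tauto
      · refine ⟨h2, ?_⟩
        subst h1
        rcases hw with rfl | h3
        · simp
        · rw [mR] at h3; tauto
    obtain ⟨c, hc⟩ := bip h (↑W : Set (Fin N)) v w (fun x hx => (hWv x hx).2) (by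
      intro x hx hxw
      rcases hW x hx with h1 | h1
      · rw [mB] at h1; exact h1.2.2
      · exact (hxw h1.1).elim)
    have cls : ∀ b, (W.filter (fun x => c x = b)).card + 1 < n := by
      intro b
      have := hI.lt (Finset.subset_univ _) (indep_union (indep_single v)
        (Y := W.filter (fun x => c x = b)) (G := G) (by
          intro x hx y hy hxy
          rw [Finset.mem_filter] at hx hy
          exact hc x hx.1 y hy.1 hxy (hx.2.trans hy.2.symm)) (by
        intro x hx y hy
        rw [Finset.mem_singleton] at hx
        subst hx
        exact (hWv y (Finset.mem_filter.1 hy).1).2))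
      rw [Finset.card_union_of_disjoint, Finset.card_singleton] at this
      · omega
      · rw [Finset.disjoint_singleton_left]
        intro hh
        exact (hWv v (Finset.mem_filter.1 hh).1).1 rfl
    have e := Finset.card_filter_add_card_filter_not (s := W) (fun x => c x = true)
    have e2 := cls true
    have e3 := cls false
    simp only [Bool.not_eq_true] at e
    omega
  rcases R.eq_empty_or_nonempty with hR0 | ⟨w, hw⟩
  · left
    have := bb v (Or.inl rfl) B (fun x hx => Or.inl hx)
    rw [hR0, Finset.card_empty] at hN
    omega
  · right
    have hwB : w ∉ B := fun hh => (Finset.disjoint_left.1 dBR) hh hw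
    have := bb w (Or.inr hw) (insert w B) (by
      intro x hx
      rw [Finset.mem_insert] at hx
      rcases hx with rfl | hx
      · exact Or.inr ⟨rfl, ((mR x).1 hw).1⟩
      · exact Or.inl hx)
    rw [Finset.card_insert_of_notMem hwB] at this
    exact ⟨A.card, by omega, by omega, by omega⟩

end T3N

theorem t3n_recursive_bound (n : ℕ) (hn : 2 ≤ n) :
    (mixedRamsey 3 n : ℤ) ≤ 3 * n - 3 ∨
    ∃ d : ℕ, d ≤ n - 1 ∧
      (mixedRamsey 3 n : ℤ) ≤ d + mixedRamsey 3 (n - 1) + 1 ∧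
      (mixedRamsey 3 n : ℤ) ≤ d + 2 * n - 5 + mixedRamsey 3 (n - d) + 1 := by
  by_cases ht : mixedRamsey 3 n ≤ 1
  · left; omega
  have hlt : mixedRamsey 3 n - 1 < mixedRamsey 3 n := by omega
  have hnot := Nat.notMem_of_lt_sInf hlt
  simp only [Set.mem_setOf_eq, not_forall] at hnot
  obtain ⟨G, hG⟩ := hnot
  push Not at hG
  have := T3N.core hn (G := G) (fun X hX => hG.1 X hX) (fun X _ hX => hG.2 X hX)
    ⟨0, by omega⟩
  rcases this with h | ⟨d, h1, h2, h3⟩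
  · left; omega
  · right
    exact ⟨d, h1, by omega, by omega⟩
end

section
/- The ratio t(4,n)/r(4,n) tends to 0 as n tends to infinity; that is, lim_{n→∞} t(4,n)/r(4,n) = 0. -/
open Classical in
lemma aux_greedy {V : Type*} (G : SimpleGraph V) (K : ℕ)
    (h : ∀ W : Finset V, W.Nonempty → ∃ J ⊆ W, J.Nonempty ∧ G.IsIndependent J ∧
      (W.filter (fun w => w ∈ J ∨ ∃ u ∈ J, G.Adj u w)).card ≤ K * J.card) :
    ∀ W : Finset V, ∃ I ⊆ W, G.IsIndependent I ∧ W.card ≤ K * I.card := by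
  intro W
  induction W using Finset.strongInduction with
  | H W ih =>
    rcases W.eq_empty_or_nonempty with rfl | hW
    · exact ⟨∅, by simp, by intro x hx; simp at hx, by simp⟩
    obtain ⟨J, hJW, hJ, hJi, hJc⟩ := h W hW
    set D := W.filter (fun w => w ∈ J ∨ ∃ u ∈ J, G.Adj u w) with hD
    have hDW : D ⊆ W := Finset.filter_subset _ _
    have hJD : J ⊆ D := by
      intro x hx
      simp only [hD, Finset.mem_filter]
      exact ⟨hJW hx, Or.inl hx⟩
    have hss : W \ D ⊂ W := by
      refine Finset.sdiff_ssubset hDW (hJ.mono hJD)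
    obtain ⟨I, hI, hIi, hIc⟩ := ih _ hss
    have hno : ∀ x ∈ J, ∀ y ∈ I, ¬ G.Adj x y := by
      intro x hx y hy hxy
      have := Finset.mem_sdiff.1 (hI hy)
      apply this.2
      simp only [hD, Finset.mem_filter]
      exact ⟨this.1, Or.inr ⟨x, hx, hxy⟩⟩
    have hdis : Disjoint J I := by
      rw [Finset.disjoint_left]
      intro x hx hxI
      exact (Finset.mem_sdiff.1 (hI hxI)).2 (hJD hx)
    refine ⟨J ∪ I, Finset.union_subset hJW (hI.trans Finset.sdiff_subset), ?_, ?_⟩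
    · intro x hx y hy
      rcases Finset.mem_union.1 hx with hx | hx <;> rcases Finset.mem_union.1 hy with hy | hy
      · exact hJi x hx y hy
      · exact hno x hx y hy
      · exact fun hxy => hno y hy x hx hxy.symm
      · exact hIi x hx y hy
    · rw [Finset.card_union_of_disjoint hdis, mul_add]
      have := Finset.card_sdiff_add_card_eq_card hDW
      omega

open Classical in
lemma aux_select {V D : Type*} (G : SimpleGraph V) (A B : V → Finset D) (K : ℕ) :
    ∀ W : Finset V, (∀ w ∈ W, ∀ w' ∈ W, G.Adj w w' → A w ⊆ B w') →
      (∀ w ∈ W, Disjoint (A w) (B w)) → (∀ w ∈ W, (A w).Nonempty) →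
      (∀ w ∈ W, (B w).card ≤ K * (A w).card) →
      ∃ I ⊆ W, G.IsIndependent I ∧ W.card ≤ (K + 1) * I.card := by
  intro W
  induction W using Finset.strongInduction with
  | H W ih =>
    intro h1 h2 h3 h4
    rcases W.eq_empty_or_nonempty with rfl | hW
    · exact ⟨∅, by simp, by intro x hx; simp at hx, by simp⟩
    -- find u
    have key : ∃ u, 0 < (W.filter (fun w => u ∈ A w)).card ∧
        (W.filter (fun w => u ∈ B w)).card ≤ K * (W.filter (fun w => u ∈ A w)).card := by
      by_contra hcon
      push Not at hcon
      set U : Finset D := W.biUnion A with hU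
      have e1 : ∑ u ∈ U, (W.filter (fun w => u ∈ A w)).card = ∑ w ∈ W, (A w).card := by
        rw [Finset.sum_card_bipartiteAbove_eq_sum_card_bipartiteBelow (fun u w => u ∈ A w)
          |> fun h => (show ∑ u ∈ U, (W.filter (fun w => u ∈ A w)).card = _ from h)]
        apply Finset.sum_congr rfl
        intro w hw
        congr 1
        ext u
        simp only [Finset.bipartiteBelow, Finset.mem_filter, hU, Finset.mem_biUnion]
        exact ⟨fun h => h.2, fun h => ⟨⟨w, hw, h⟩, h⟩⟩
      have e2 : ∑ u ∈ U, (W.filter (fun w => u ∈ B w)).card ≤ ∑ w ∈ W, (B w).card := by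
        rw [Finset.sum_card_bipartiteAbove_eq_sum_card_bipartiteBelow (fun u w => u ∈ B w)
          |> fun h => (show ∑ u ∈ U, (W.filter (fun w => u ∈ B w)).card = _ from h)]
        apply Finset.sum_le_sum
        intro w hw
        apply Finset.card_le_card
        intro u
        simp only [Finset.bipartiteBelow, Finset.mem_filter]
        exact fun h => h.2
      have e3 : ∑ u ∈ U, K * (W.filter (fun w => u ∈ A w)).card
          < ∑ u ∈ U, (W.filter (fun w => u ∈ B w)).card := by
        apply Finset.sum_lt_sum_of_nonempty
        · obtain ⟨w, hw⟩ := hW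
          obtain ⟨u, hu⟩ := h3 w hw
          exact ⟨u, Finset.mem_biUnion.2 ⟨w, hw, hu⟩⟩
        · intro u hu
          apply hcon
          obtain ⟨w, hw, hu⟩ := Finset.mem_biUnion.1 hu
          exact Finset.card_pos.2 ⟨w, Finset.mem_filter.2 ⟨hw, hu⟩⟩
      have e4 : ∑ w ∈ W, (B w).card ≤ ∑ w ∈ W, K * (A w).card := Finset.sum_le_sum h4
      rw [← Finset.mul_sum] at e3 e4
      rw [e1] at e3
      omega
    obtain ⟨u, hu0, hu⟩ := key
    set P := W.filter (fun w => u ∈ A w) with hP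
    set Q := W.filter (fun w => u ∈ B w) with hQ
    set W' := W.filter (fun w => u ∉ A w ∧ u ∉ B w) with hW'
    have hsub : W' ⊆ W := Finset.filter_subset _ _
    have hss : W' ⊂ W := by
      refine Finset.ssubset_iff_subset_ne.2 ⟨hsub, ?_⟩
      intro heq
      obtain ⟨w, hw⟩ := Finset.card_pos.1 hu0
      have hw2 := Finset.mem_filter.1 hw
      have : w ∈ W' := heq ▸ hw2.1
      exact (Finset.mem_filter.1 this).2.1 hw2.2
    obtain ⟨I, hI, hIi, hIc⟩ := ih W' hss
      (fun w hw w' hw' => h1 w (hsub hw) w' (hsub hw')) (fun w hw => h2 w (hsub hw))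
      (fun w hw => h3 w (hsub hw)) (fun w hw => h4 w (hsub hw))
    have hno : ∀ x ∈ P, ∀ y ∈ I, ¬ G.Adj x y := by
      intro x hx y hy hxy
      have hx := Finset.mem_filter.1 hx
      have hy := Finset.mem_filter.1 (hI hy)
      exact hy.2.2 (h1 x hx.1 y hy.1 hxy hx.2)
    have hdis : Disjoint P I := by
      rw [Finset.disjoint_left]
      intro x hx hxI
      exact (Finset.mem_filter.1 (hI hxI)).2.1 (Finset.mem_filter.1 hx).2
    refine ⟨P ∪ I, Finset.union_subset (Finset.filter_subset _ _) (hI.trans hsub), ?_, ?_⟩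
    · intro x hx y hy
      rcases Finset.mem_union.1 hx with hx | hx <;> rcases Finset.mem_union.1 hy with hy | hy
      · intro hxy
        have hx := Finset.mem_filter.1 hx
        have hy := Finset.mem_filter.1 hy
        exact Finset.disjoint_left.1 (h2 y hy.1) hy.2 (h1 x hx.1 y hy.1 hxy hx.2)
      · exact hno x hx y hy
      · exact fun hxy => hno y hy x hx hxy.symm
      · exact hIi x hx y hy
    · rw [Finset.card_union_of_disjoint hdis]
      have hc : W ⊆ (P ∪ Q) ∪ W' := by
        intro w hw
        simp only [hP, hQ, hW', Finset.mem_union, Finset.mem_filter]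
        tauto
      have := (Finset.card_le_card hc).trans (Finset.card_union_le _ _)
      have := Finset.card_union_le P Q
      nlinarith

open Classical in
lemma aux_n2 {V : Type*} [Fintype V] (G : SimpleGraph V) (n : ℕ)
    (htri : ∀ x y z, G.Adj x y → G.Adj y z → ¬ G.Adj x z)
    (hC : ∀ x1 x2 x3 y1 y2 y3, G.Adj x2 y1 → G.Adj x3 y1 → ¬ G.Adj x1 y1 → x1 ≠ y1 →
      G.Adj x1 y2 → G.Adj x3 y2 → ¬ G.Adj x2 y2 → x2 ≠ y2 →
      G.Adj x1 y3 → G.Adj x2 y3 → ¬ G.Adj x3 y3 → x3 ≠ y3 → False)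
    (hI : ∀ I : Finset V, G.IsIndependent I → I.card < n) (v : V) :
    (Finset.univ.filter (fun z => z ≠ v ∧ ∃ u, G.Adj v u ∧ G.Adj u z)).card
      ≤ 3 * n * (Nat.log 2 n + 1) := by
  set Z := Finset.univ.filter (fun z => z ≠ v ∧ ∃ u, G.Adj v u ∧ G.Adj u z) with hZ
  set tr : V → Finset V := fun z => Finset.univ.filter (fun u => G.Adj v u ∧ G.Adj u z) with htr
  have hZnv : ∀ z ∈ Z, ¬ G.Adj v z := by
    intro z hz
    obtain ⟨-, u, h1, h2⟩ := (Finset.mem_filter.1 hz).2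
    exact htri v u z h1 h2
  have htrn : ∀ z ∈ Z, (tr z).Nonempty := by
    intro z hz
    obtain ⟨-, u, h1, h2⟩ := (Finset.mem_filter.1 hz).2
    exact ⟨u, by simp [htr, h1, h2]⟩
  have htrc : ∀ z, (tr z).card < n := by
    intro z
    apply hI
    intro x hx y hy hxy
    simp only [htr, Finset.mem_filter, Finset.mem_univ, true_and] at hx hy
    exact htri v x y hx.1 hxy hy.1
  have hchain : ∀ w ∈ Z, ∀ z1 ∈ Z, ∀ z2 ∈ Z, G.Adj w z1 → G.Adj w z2 →
      tr z1 ⊆ tr z2 ∨ tr z2 ⊆ tr z1 := by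
    intro w hw z1 hz1 z2 hz2 h1 h2
    by_contra hcon
    push Not at hcon
    obtain ⟨u1, hu1, hu1'⟩ := Finset.not_subset.1 hcon.1
    obtain ⟨u2, hu2, hu2'⟩ := Finset.not_subset.1 hcon.2
    simp only [htr, Finset.mem_filter, Finset.mem_univ, true_and, not_and] at hu1 hu1' hu2 hu2'
    refine hC v z1 z2 w u2 u1 h1.symm h2.symm (hZnv w hw) ?_ hu2.1 hu2.2.symm ?_ ?_ hu1.1
      hu1.2.symm ?_ ?_
    · exact fun h => (Finset.mem_filter.1 hw).2.1 h.symm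
    · exact fun h => hu2' hu2.1 h.symm
    · rintro rfl; exact hZnv _ hz1 hu2.1
    · exact fun h => hu1' hu1.1 h.symm
    · rintro rfl; exact hZnv _ hz2 hu1.1
  have hdisj : ∀ w w', G.Adj w w' → Disjoint (tr w) (tr w') := by
    intro w w' h
    rw [Finset.disjoint_left]
    intro u hu hu'
    simp only [htr, Finset.mem_filter, Finset.mem_univ, true_and] at hu hu'
    exact htri u w w' hu.2 h hu'.2
  -- classes
  have hclass : ∀ i, (Z.filter (fun z => Nat.log 2 (tr z).card = i)).card ≤ 3 * n := by
    intro i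
    set Y := Z.filter (fun z => Nat.log 2 (tr z).card = i) with hY
    set W := Y.filter (fun z => ∃ w ∈ Y, G.Adj z w) with hW
    set O := Y.filter (fun z => ¬ ∃ w ∈ Y, G.Adj z w) with hO
    have hYZ : Y ⊆ Z := Finset.filter_subset _ _
    have hWY : W ⊆ Y := Finset.filter_subset _ _
    have hbd : ∀ z ∈ Y, ∀ z' ∈ Y, (tr z).card ≤ 2 * (tr z').card := by
      intro z hz z' hz'
      have e1 := (Finset.mem_filter.1 hz).2
      have e2 := (Finset.mem_filter.1 hz').2
      have h1 := Nat.lt_pow_succ_log_self (b := 2) (by norm_num) (tr z).card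
      have h2 := Nat.pow_log_le_self 2 (x := (tr z').card)
        (Finset.card_pos.2 (htrn z' (hYZ hz'))).ne'
      rw [e1, pow_succ] at h1
      rw [e2] at h2
      omega
    have hmin : ∀ w ∈ W, ∃ z ∈ Y, G.Adj w z ∧ ∀ z' ∈ Y, G.Adj w z' → tr z ⊆ tr z' := by
      intro w hw
      obtain ⟨hwY, z0, hz0, hwz0⟩ := Finset.mem_filter.1 hw
      obtain ⟨z, hz, hzm⟩ := Finset.exists_min_image (Y.filter (fun z => G.Adj w z))
        (fun z => (tr z).card) ⟨z0, Finset.mem_filter.2 ⟨hz0, hwz0⟩⟩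
      have hz := Finset.mem_filter.1 hz
      refine ⟨z, hz.1, hz.2, ?_⟩
      intro z' hz' hwz'
      rcases hchain w (hYZ hwY) z (hYZ hz.1) z' (hYZ hz') hz.2 hwz' with h | h
      · exact h
      · exact (Finset.eq_of_subset_of_card_le h
          (hzm z' (Finset.mem_filter.2 ⟨hz', hwz'⟩))).symm.subset
    choose! f hf1 hf2 hf3 using hmin
    obtain ⟨I, hIW, hIi, hIc⟩ := aux_select G (fun w => tr (f w)) tr 2 W
      (fun w hw w' hw' h => hf3 w hw w' (hWY hw') h)
      (fun w hw => (hdisj _ _ (hf2 w hw)).symm)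
      (fun w hw => htrn _ (hYZ (hf1 w hw)))
      (fun w hw => hbd _ (hWY hw) _ (hf1 w hw))
    have hOI : Disjoint O I := by
      rw [Finset.disjoint_left]
      intro x hx hx'
      exact (Finset.mem_filter.1 hx).2 (Finset.mem_filter.1 (hIW hx')).2
    have := hI (O ∪ I) (by
      intro x hx y hy hxy
      rcases Finset.mem_union.1 hx with hx | hx <;> rcases Finset.mem_union.1 hy with hy | hy
      · exact (Finset.mem_filter.1 hx).2 ⟨y, (Finset.mem_filter.1 hy).1, hxy⟩
      · exact (Finset.mem_filter.1 hx).2 ⟨y, hWY (hIW hy), hxy⟩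
      · exact (Finset.mem_filter.1 hy).2 ⟨x, hWY (hIW hx), hxy.symm⟩
      · exact hIi x hx y hy hxy)
    rw [Finset.card_union_of_disjoint hOI] at this
    have hs : W.card + O.card = Y.card := Finset.card_filter_add_card_filter_not _
    omega
  have hmaps : ∀ z ∈ Z, Nat.log 2 (tr z).card ∈ Finset.range (Nat.log 2 n + 1) := by
    intro z _
    rw [Finset.mem_range]
    exact Nat.lt_succ_of_le (Nat.log_mono_right (htrc z).le)
  rw [Finset.card_eq_sum_card_fiberwise hmaps]
  refine (Finset.sum_le_card_nsmul _ _ (3 * n) (fun i _ => hclass i)).trans ?_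
  simp [mul_comm]

/-- the degree bound -/
def auxK (n : ℕ) : ℕ := 3 * (Nat.log 2 n + 1) * (Nat.sqrt n + 1) + 3

open Classical in
lemma aux_t3 {V : Type*} [Fintype V] (G : SimpleGraph V) (n : ℕ)
    (htri : ∀ x y z, G.Adj x y → G.Adj y z → ¬ G.Adj x z)
    (hC : ∀ x1 x2 x3 y1 y2 y3, G.Adj x2 y1 → G.Adj x3 y1 → ¬ G.Adj x1 y1 → x1 ≠ y1 →
      G.Adj x1 y2 → G.Adj x3 y2 → ¬ G.Adj x2 y2 → x2 ≠ y2 →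
      G.Adj x1 y3 → G.Adj x2 y3 → ¬ G.Adj x3 y3 → x3 ≠ y3 → False)
    (hI : ∀ I : Finset V, G.IsIndependent I → I.card < n) :
    Fintype.card V ≤ auxK n * n := by
  obtain ⟨I, -, hIi, hIc⟩ := aux_greedy G (auxK n) (by
    intro W hW
    obtain ⟨v, hv⟩ := hW
    by_cases hd : (W.filter (fun u => G.Adj v u)).card ≤ Nat.sqrt n
    · refine ⟨{v}, by simpa using hv, by simp, ?_, ?_⟩
      · intro x hx y hy
        rw [Finset.mem_singleton] at hx hy
        subst hx; subst hy
        exact G.loopless.irrefl _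
      · have hs : (W.filter (fun w => w ∈ ({v} : Finset V) ∨ ∃ u ∈ ({v} : Finset V), G.Adj u w))
            ⊆ insert v (W.filter (fun u => G.Adj v u)) := by
          intro w
          simp only [Finset.mem_filter, Finset.mem_singleton, Finset.mem_insert]
          rintro ⟨h1, h2 | ⟨u, rfl, h3⟩⟩
          · exact Or.inl h2
          · exact Or.inr ⟨h1, h3⟩
        have := (Finset.card_le_card hs).trans (Finset.card_insert_le _ _)
        rw [Finset.card_singleton, auxK]
        nlinarith [Nat.zero_le (Nat.log 2 n), Nat.zero_le (Nat.sqrt n),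
          Nat.zero_le (Nat.log 2 n * Nat.sqrt n)]
    · push Not at hd
      set J := W.filter (fun u => G.Adj v u) with hJ
      refine ⟨J, Finset.filter_subset _ _, Finset.card_pos.1 (by omega), ?_, ?_⟩
      · intro x hx y hy hxy
        exact htri v x y (Finset.mem_filter.1 hx).2 hxy (Finset.mem_filter.1 hy).2
      · have h2 := aux_n2 G n htri hC hI v
        set Z := Finset.univ.filter (fun z => z ≠ v ∧ ∃ u, G.Adj v u ∧ G.Adj u z) with hZ
        have hs : (W.filter (fun w => w ∈ J ∨ ∃ u ∈ J, G.Adj u w)) ⊆ insert v (J ∪ Z) := by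
          intro w hw
          obtain ⟨h1, h2⟩ := Finset.mem_filter.1 hw
          rw [Finset.mem_insert, Finset.mem_union]
          by_cases hwv : w = v
          · exact Or.inl hwv
          right
          rcases h2 with h2 | ⟨u, hu, huw⟩
          · exact Or.inl h2
          · right
            exact Finset.mem_filter.2 ⟨Finset.mem_univ _, hwv, u, (Finset.mem_filter.1 hu).2, huw⟩
        have h3 := (Finset.card_le_card hs).trans (Finset.card_insert_le _ _)
        have h4 := Finset.card_union_le J Z
        have h5 : n ≤ (Nat.sqrt n + 1) * (Nat.sqrt n + 1) := (Nat.lt_succ_sqrt n).le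
        have h6 : 3 * n * (Nat.log 2 n + 1)
            ≤ 3 * (Nat.log 2 n + 1) * (Nat.sqrt n + 1) * J.card := by
          calc 3 * n * (Nat.log 2 n + 1) ≤ 3 * ((Nat.sqrt n + 1) * (Nat.sqrt n + 1))
                * (Nat.log 2 n + 1) := by gcongr
            _ = 3 * (Nat.log 2 n + 1) * (Nat.sqrt n + 1) * (Nat.sqrt n + 1) := by ring
            _ ≤ _ := by gcongr; omega
        rw [auxK, add_mul]
        omega) Finset.univ
  rw [Finset.card_univ] at hIc
  exact hIc.trans (Nat.mul_le_mul_left _ (hI I hIi).le)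

open Classical in
lemma aux_t4 (n : ℕ) (hn : 0 < n) : mixedRamsey 4 n ≤ (auxK n * n + 1) * n := by
  apply Nat.sInf_le
  intro G
  by_contra hcon
  push Not at hcon
  obtain ⟨hirr, hind⟩ := hcon
  have hI : ∀ I, G.IsIndependent I → I.card < n := by
    intro I hI
    by_contra hlt
    push Not at hlt
    obtain ⟨J, hJ, hJc⟩ := Finset.exists_subset_card_eq hlt
    exact hind J hJc (fun x hx y hy => hI x (hJ hx) y (hJ hy))
  have hdeg : ∀ v, Fintype.card {x // G.Adj v x} ≤ auxK n * n := by
    intro v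
    apply aux_t3 (G.comap (Subtype.val : {x // G.Adj v x} → _)) n
    · rintro ⟨x, hx⟩ ⟨y, hy⟩ ⟨z, hz⟩ h1 h2 h3
      simp only [SimpleGraph.comap_adj] at h1 h2 h3
      refine hirr {v, x, y, z} ?_ ?_
      · have := hx.ne; have := hy.ne; have := hz.ne
        have := h1.ne; have := h2.ne; have := h3.ne
        rw [Finset.card_insert_of_notMem, Finset.card_insert_of_notMem,
          Finset.card_insert_of_notMem, Finset.card_singleton] <;> simp <;> tauto
      · intro a ha
        left
        intro b hb
        simp only [Finset.mem_insert, Finset.mem_singleton] at ha hb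
        rw [SimpleGraph.compl_adj]
        have := hx.symm; have := hy.symm; have := hz.symm
        have := h1.symm; have := h2.symm; have := h3.symm
        rcases ha with rfl | rfl | rfl | rfl <;> rcases hb with rfl | rfl | rfl | rfl <;> tauto
    · rintro ⟨x1, hx1⟩ ⟨x2, hx2⟩ ⟨x3, hx3⟩ ⟨y1, hy1⟩ ⟨y2, hy2⟩ ⟨y3, hy3⟩ a1 a2 a3 a4 b1 b2 b3 b4
        c1 c2 c3 c4
      simp only [SimpleGraph.comap_adj, ne_eq, Subtype.mk.injEq] at a1 a2 a3 a4 b1 b2 b3 b4 c1 c2 c3 c4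
      have d12 : x1 ≠ x2 := by rintro rfl; exact a3 a1
      have d13 : x1 ≠ x3 := by rintro rfl; exact a3 a2
      have d23 : x2 ≠ x3 := by rintro rfl; exact b3 b2
      have n1 := hx1.ne; have n2 := hx2.ne; have n3 := hx3.ne
      have m1 := hy1.ne; have m2 := hy2.ne; have m3 := hy3.ne
      have p1 := a1.ne; have p2 := a2.ne; have p3 := b1.ne; have p4 := b2.ne
      have p5 := c1.ne; have p6 := c2.ne
      refine hirr {v, x1, x2, x3} ?_ ?_
      · rw [Finset.card_insert_of_notMem, Finset.card_insert_of_notMem,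
          Finset.card_insert_of_notMem, Finset.card_singleton] <;> simp <;> tauto
      · intro a ha
        simp only [Finset.mem_insert, Finset.mem_singleton, SimpleGraph.compl_adj] at ha ⊢
        rcases ha with rfl | rfl | rfl | rfl
        · left
          intro b hb
          rcases hb with rfl | rfl | rfl | rfl <;> tauto
        · right
          refine ⟨y1, by grind, ⟨a4, a3⟩, ?_⟩
          rintro z (rfl | rfl | rfl | rfl) hz <;> tauto
        · right
          refine ⟨y2, by grind, ⟨b4, b3⟩, ?_⟩
          rintro z (rfl | rfl | rfl | rfl) hz <;> tauto
        · right
          refine ⟨y3, by grind, ⟨c4, c3⟩, ?_⟩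
          rintro z (rfl | rfl | rfl | rfl) hz <;> tauto
    · intro I hIi
      have := hI (I.map ⟨Subtype.val, Subtype.val_injective⟩) (by
        intro x hx y hy
        simp only [Finset.mem_map, Function.Embedding.coeFn_mk] at hx hy
        obtain ⟨x, hx, rfl⟩ := hx
        obtain ⟨y, hy, rfl⟩ := hy
        exact hIi x hx y hy)
      simpa using this
  obtain ⟨I, -, hIi, hIc⟩ := aux_greedy G (auxK n * n + 1) (by
    intro W hW
    obtain ⟨v, hv⟩ := hW
    refine ⟨{v}, by simpa using hv, by simp, ?_, ?_⟩
    · intro x hx y hy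
      rw [Finset.mem_singleton] at hx hy
      subst hx; subst hy
      exact G.loopless.irrefl _
    · have hs : (W.filter (fun w => w ∈ ({v} : Finset _) ∨ ∃ u ∈ ({v} : Finset _), G.Adj u w))
          ⊆ insert v (Finset.univ.filter (fun u => G.Adj v u)) := by
        intro w
        simp only [Finset.mem_filter, Finset.mem_singleton, Finset.mem_insert]
        rintro ⟨h1, h2 | ⟨u, rfl, h3⟩⟩
        · exact Or.inl h2
        · exact Or.inr ⟨Finset.mem_univ _, h3⟩
      have h1 := (Finset.card_le_card hs).trans (Finset.card_insert_le _ _)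
      have h2 := hdeg v
      rw [Fintype.card_subtype] at h2
      rw [Finset.card_singleton, mul_one]
      refine le_of_eq_of_le ?_ (h1.trans (Nat.add_le_add_right h2 1))
      congr!) Finset.univ
  rw [Finset.card_univ, Fintype.card_fin] at hIc
  have h1 := hI I hIi
  have h2 : (auxK n * n + 1) * I.card < (auxK n * n + 1) * n :=
    Nat.mul_lt_mul_of_pos_left h1 (by omega)
  omega
open Classical in
lemma aux_boolsum {L : Type*} [Fintype L] (X : Finset L) (b : Bool) :
    ∑ f : L → Bool, (1 / 2 : ℝ) ^ (X.filter (fun l => f l = b)).card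
      = 2 ^ (Fintype.card L) * (3 / 4) ^ X.card := by
  have h := Finset.prod_univ_sum (fun _ : L => (Finset.univ : Finset Bool))
    (fun l c => if l ∈ X ∧ c = b then (1 / 2 : ℝ) else 1)
  rw [Fintype.piFinset_univ] at h
  have h1 : ∀ f : L → Bool, (1 / 2 : ℝ) ^ (X.filter (fun l => f l = b)).card
      = ∏ l, if l ∈ X ∧ f l = b then (1 / 2 : ℝ) else 1 := by
    intro f
    rw [Finset.prod_ite, Finset.prod_const_one, mul_one, Finset.prod_const]
    congr 2
    ext l; simp
  simp_rw [h1]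
  rw [← h]
  have h2 : ∀ l : L, ∑ c : Bool, (if l ∈ X ∧ c = b then (1 / 2 : ℝ) else 1)
      = 2 * (if l ∈ X then (3 / 4 : ℝ) else 1) := by
    intro l
    by_cases hl : l ∈ X <;> cases b <;> simp [hl] <;> norm_num
  simp_rw [h2]
  rw [Finset.prod_mul_distrib, Finset.prod_const, Finset.prod_ite, Finset.prod_const_one, mul_one,
    Finset.prod_const, Finset.card_univ]
  congr 3
  ext l; simp

lemma aux_half (a b : ℕ) : (1 / 2 : ℝ) ^ (a * b) ≤ (1 / 2) ^ a + (1 / 2) ^ b := by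
  rcases Nat.eq_zero_or_pos b with rfl | hb
  · simp
  · have : (1 / 2 : ℝ) ^ (a * b) ≤ (1 / 2) ^ a :=
      pow_le_pow_of_le_one (by norm_num) (by norm_num) (Nat.le_mul_of_pos_right a hb)
    have : (0 : ℝ) ≤ (1 / 2) ^ b := by positivity
    linarith

open Classical in
/-- number of differently coloured pairs of lines of X at the point p -/
noncomputable def auxE {P L : Type*} [Fintype P] (inc : L → Finset P) (X : Finset L)
    (c : P → L → Bool) : ℕ :=
  ∑ p, (X.filter (fun l => p ∈ inc l ∧ c p l = true)).card *
    (X.filter (fun l => p ∈ inc l ∧ c p l = false)).card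

open Classical in
lemma aux_markov {P L : Type*} [Fintype P] [Fintype L] (inc : L → Finset P) (X : Finset L)
    (q : ℕ) (hq : ∀ l, q ≤ (inc l).card) (E0 : ℕ) :
    ((Finset.univ.filter (fun c : P → L → Bool => auxE inc X c ≤ E0)).card : ℝ)
      ≤ 2 ^ E0 * ((2 ^ Fintype.card L) ^ Fintype.card P * 2 ^ Fintype.card P
        * (3 / 4) ^ (X.card * q)) := by
  have h1 : ∑ c : P → L → Bool, (1 / 2 : ℝ) ^ auxE inc X c
      ≤ (2 ^ Fintype.card L) ^ Fintype.card P * 2 ^ Fintype.card P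
        * (3 / 4) ^ (X.card * q) := by
    have h := Finset.prod_univ_sum (fun _ : P => (Finset.univ : Finset (L → Bool)))
      (fun p f => (1 / 2 : ℝ) ^ ((X.filter (fun l => p ∈ inc l ∧ f l = true)).card *
        (X.filter (fun l => p ∈ inc l ∧ f l = false)).card))
    rw [Fintype.piFinset_univ] at h
    have e : ∀ c : P → L → Bool, (1 / 2 : ℝ) ^ auxE inc X c =
        ∏ p, (1 / 2 : ℝ) ^ ((X.filter (fun l => p ∈ inc l ∧ c p l = true)).card *
        (X.filter (fun l => p ∈ inc l ∧ c p l = false)).card) := by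
      intro c
      rw [auxE, Finset.prod_pow_eq_pow_sum]
    simp_rw [e]
    rw [← h]
    have hp : ∀ p : P, ∑ f : L → Bool,
        (1 / 2 : ℝ) ^ ((X.filter (fun l => p ∈ inc l ∧ f l = true)).card *
        (X.filter (fun l => p ∈ inc l ∧ f l = false)).card)
        ≤ 2 ^ Fintype.card L * 2 * (3 / 4) ^ (X.filter (fun l => p ∈ inc l)).card := by
      intro p
      have h2 := aux_boolsum (X.filter (fun l => p ∈ inc l)) true
      have h3 := aux_boolsum (X.filter (fun l => p ∈ inc l)) false
      simp_rw [Finset.filter_filter] at h2 h3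
      calc _ ≤ ∑ f : L → Bool, ((1 / 2 : ℝ) ^ (X.filter (fun l => p ∈ inc l ∧ f l = true)).card
            + (1 / 2 : ℝ) ^ (X.filter (fun l => p ∈ inc l ∧ f l = false)).card) :=
            Finset.sum_le_sum (fun f _ => aux_half _ _)
        _ = _ := by rw [Finset.sum_add_distrib, h2, h3]; ring
    calc _ ≤ ∏ p : P, (2 ^ Fintype.card L * 2 *
          (3 / 4 : ℝ) ^ (X.filter (fun l => p ∈ inc l)).card) :=
          Finset.prod_le_prod (fun p _ => Finset.sum_nonneg (fun _ _ => by positivity))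
            (fun p _ => hp p)
      _ = (2 ^ Fintype.card L) ^ Fintype.card P * 2 ^ Fintype.card P
        * (3 / 4 : ℝ) ^ (∑ p : P, (X.filter (fun l => p ∈ inc l)).card) := by
          rw [Finset.prod_mul_distrib, Finset.prod_mul_distrib, Finset.prod_const,
            Finset.prod_const, Finset.card_univ, Finset.prod_pow_eq_pow_sum]
      _ ≤ _ := by
          gcongr ?_ * ?_
          apply pow_le_pow_of_le_one (by norm_num) (by norm_num)
          have e2 := Finset.sum_card_bipartiteAbove_eq_sum_card_bipartiteBelow
            (s := (Finset.univ : Finset P)) (t := X) (fun p l => p ∈ inc l)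
          have e3 : ∑ p : P, (X.filter (fun l => p ∈ inc l)).card = ∑ l ∈ X, (inc l).card := by
            refine Eq.trans e2 ?_
            apply Finset.sum_congr rfl
            intro l _
            congr 1
            ext p; simp [Finset.bipartiteBelow]
          rw [e3, ← smul_eq_mul]
          exact Finset.card_nsmul_le_sum _ _ _ (fun l _ => hq l)
  have h4 : ((Finset.univ.filter (fun c : P → L → Bool => auxE inc X c ≤ E0)).card : ℝ)
      * (1 / 2) ^ E0 ≤ ∑ c : P → L → Bool, (1 / 2 : ℝ) ^ auxE inc X c := by
    rw [← nsmul_eq_mul]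
    refine (Finset.card_nsmul_le_sum _ _ _ ?_).trans
      (Finset.sum_le_sum_of_subset_of_nonneg (Finset.filter_subset _ _)
        (fun _ _ _ => by positivity))
    intro c hc
    exact pow_le_pow_of_le_one (by norm_num) (by norm_num) (Finset.mem_filter.1 hc).2
  have h5 := h4.trans h1
  have h6 : ((1 : ℝ) / 2) ^ E0 * 2 ^ E0 = 1 := by rw [← mul_pow]; norm_num
  calc _ = ((Finset.univ.filter (fun c : P → L → Bool => auxE inc X c ≤ E0)).card : ℝ)
      * (1 / 2) ^ E0 * 2 ^ E0 := by rw [mul_assoc, h6, mul_one]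
    _ ≤ _ := by
      rw [mul_comm (2 ^ E0 : ℝ)]
      gcongr

open Classical in
lemma aux_color {P L : Type*} [Fintype P] [Fintype L] (inc : L → Finset P) (j q : ℕ)
    (hqj : q = 2 ^ j) (hj : 20 * j < q)
    (hq : ∀ l, q ≤ (inc l).card) (hP : Fintype.card P ≤ q ^ 3) (hL : Fintype.card L ≤ q ^ 4) :
    ∃ c : P → L → Bool, ∀ X : Finset L, X.card = 10 * q ^ 2 → q ^ 3 < auxE inc X c := by
  by_contra hcon
  push Not at hcon
  set m := 10 * q ^ 2 with hm
  have hcov : (Finset.univ : Finset (P → L → Bool)) ⊆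
      (Finset.powersetCard m (Finset.univ : Finset L)).biUnion (fun X =>
        Finset.univ.filter (fun c : P → L → Bool => auxE inc X c ≤ q ^ 3)) := by
    intro c _
    obtain ⟨X, h1, h2⟩ := hcon c
    rw [Finset.mem_biUnion]
    exact ⟨X, by rw [Finset.mem_powersetCard]; exact ⟨Finset.subset_univ _, h1⟩,
      Finset.mem_filter.2 ⟨Finset.mem_univ _, h2⟩⟩
  have h1 := (Finset.card_le_card hcov).trans Finset.card_biUnion_le
  have h2 : ((Fintype.card (P → L → Bool) : ℕ) : ℝ) ≤
      ∑ X ∈ Finset.powersetCard m (Finset.univ : Finset L),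
      2 ^ (q ^ 3) * ((2 ^ Fintype.card L) ^ Fintype.card P * 2 ^ Fintype.card P
        * (3 / 4 : ℝ) ^ (m * q)) := by
    rw [Finset.card_univ] at h1
    refine (Nat.cast_le.2 h1).trans ?_
    rw [Nat.cast_sum]
    apply Finset.sum_le_sum
    intro X hX
    have := aux_markov inc X q hq (q ^ 3)
    rwa [(Finset.mem_powersetCard.1 hX).2] at this
  rw [Finset.sum_const, Finset.card_powersetCard, nsmul_eq_mul, Finset.card_univ] at h2
  simp only [Fintype.card_fun, Fintype.card_bool, Nat.cast_pow, Nat.cast_ofNat] at h2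
  have h3 : (1 : ℝ) ≤ ((Fintype.card L).choose m : ℝ) * (2 ^ (q ^ 3) * (2 ^ Fintype.card P
        * (3 / 4 : ℝ) ^ (m * q))) := by
    have hpos : (0 : ℝ) < (2 ^ Fintype.card L) ^ Fintype.card P := by positivity
    refine le_of_mul_le_mul_left ?_ hpos
    calc _ = ((2 : ℝ) ^ Fintype.card L) ^ Fintype.card P := by ring
      _ ≤ _ := h2
      _ = _ := by ring
  have h4 : ((Fintype.card L).choose m : ℝ) ≤ 2 ^ (4 * j * m) := by
    have a : (Fintype.card L).choose m ≤ (q ^ 4) ^ m :=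
      (Nat.choose_le_pow _ _).trans (Nat.pow_le_pow_left hL m)
    have b : (q ^ 4) ^ m = 2 ^ (4 * j * m) := by
      rw [hqj, ← pow_mul, ← pow_mul]; congr 1; ring
    rw [b] at a
    exact_mod_cast a
  have h5 : (3 / 4 : ℝ) ^ (m * q) ≤ (1 / 2) ^ (4 * q ^ 3) := by
    have : m * q = 5 * (2 * q ^ 3) := by rw [hm]; ring
    rw [this, pow_mul (3 / 4 : ℝ), show 4 * q ^ 3 = 2 * (2 * q ^ 3) by ring, pow_mul (1 / 2 : ℝ)]
    exact pow_le_pow_left₀ (by positivity) (by norm_num) _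
  have h6 : (2 : ℝ) ^ Fintype.card P ≤ 2 ^ (q ^ 3) := pow_le_pow_right₀ (by norm_num) hP
  have hlt : 4 * j * m + (q ^ 3 + q ^ 3) < 4 * q ^ 3 := by
    have hq0 : 0 < q := by omega
    have : 20 * j * (2 * q ^ 2) < q * (2 * q ^ 2) := Nat.mul_lt_mul_of_pos_right hj (by positivity)
    rw [hm]
    nlinarith
  have h7 : ((Fintype.card L).choose m : ℝ) * (2 ^ (q ^ 3) * (2 ^ Fintype.card P
        * (3 / 4 : ℝ) ^ (m * q))) ≤ 2 ^ (4 * j * m) * (2 ^ (q ^ 3) * (2 ^ (q ^ 3)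
        * (1 / 2 : ℝ) ^ (4 * q ^ 3))) := by gcongr
  have h8 : (2 : ℝ) ^ (4 * j * m) * (2 ^ (q ^ 3) * (2 ^ (q ^ 3)
        * (1 / 2 : ℝ) ^ (4 * q ^ 3))) < 1 := by
    have : (2 : ℝ) ^ (4 * j * m) * (2 ^ (q ^ 3) * (2 ^ (q ^ 3)
        * (1 / 2 : ℝ) ^ (4 * q ^ 3))) = 2 ^ (4 * j * m + (q ^ 3 + q ^ 3)) / 2 ^ (4 * q ^ 3) := by
      rw [pow_add, pow_add, one_div, inv_pow]; ring
    rw [this, div_lt_one (by positivity)]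
    exact pow_lt_pow_right₀ (by norm_num) hlt
  linarith

open Classical in
/-- weighted count of independent subsets -/
noncomputable def auxI {V : Type*} (G : SimpleGraph V) (lam : ℝ) (A : Finset V) : ℝ :=
  ∑ T ∈ A.powerset, if G.IsIndependent T then lam ^ T.card else 0

open Classical in
lemma auxI_le_base {V : Type*} (G : SimpleGraph V) (lam : ℝ) (hl : 0 ≤ lam) (A : Finset V) :
    auxI G lam A ≤ (1 + lam) ^ A.card := by
  have h := Finset.sum_pow_mul_eq_add_pow lam 1 A
  rw [add_comm 1 lam, ← h, auxI]
  apply Finset.sum_le_sum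
  intro T _
  split_ifs
  · simp
  · positivity

open Classical in
lemma auxI_rec {V : Type*} (G : SimpleGraph V) (lam : ℝ) (hl : 0 ≤ lam) (A : Finset V) (v : V)
    (hv : v ∈ A) :
    auxI G lam A ≤ auxI G lam (A.erase v)
      + lam * auxI G lam ((A.erase v).filter (fun w => ¬ G.Adj v w)) := by
  have hA : A = insert v (A.erase v) := (Finset.insert_erase hv).symm
  conv_lhs => rw [auxI, hA, Finset.sum_powerset_insert (Finset.notMem_erase v A)]
  rw [auxI, auxI]
  apply add_le_add le_rfl
  rw [Finset.mul_sum]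
  set B := A.erase v with hB
  have hsub : (B.filter (fun w => ¬ G.Adj v w)).powerset ⊆ B.powerset :=
    Finset.powerset_mono.2 (Finset.filter_subset _ _)
  have hz : ∀ T ∈ B.powerset, T ∉ (B.filter (fun w => ¬ G.Adj v w)).powerset →
      (if G.IsIndependent (insert v T) then lam ^ (insert v T).card else 0) = 0 := by
    intro T hT hT'
    rw [Finset.mem_powerset] at hT hT'
    rw [if_neg]
    intro hi
    apply hT'
    intro w hw
    exact Finset.mem_filter.2 ⟨hT hw, hi v (Finset.mem_insert_self _ _) w
      (Finset.mem_insert_of_mem hw)⟩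
  rw [← Finset.sum_subset hsub hz]
  apply Finset.sum_le_sum
  intro T hT
  have hT := Finset.mem_powerset.1 hT
  have hvT : v ∉ T := fun h => Finset.notMem_erase v A (Finset.mem_filter.1 (hT h)).1
  rw [Finset.card_insert_of_notMem hvT]
  by_cases h1 : G.IsIndependent (insert v T)
  · have h2 : G.IsIndependent T := fun x hx y hy =>
      h1 x (Finset.mem_insert_of_mem hx) y (Finset.mem_insert_of_mem hy)
    rw [if_pos h1, if_pos h2, pow_succ, mul_comm]
  · rw [if_neg h1]
    split_ifs <;> positivity

open Classical in
lemma aux_kw {V : Type*} (G : SimpleGraph V) (lam : ℝ) (hl : 0 ≤ lam) (hl1 : lam ≤ 1) (m : ℕ)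
    (β : ℝ) (hβ1 : β ≤ 1)
    (hdeg : ∀ A : Finset V, m < A.card → ∃ v ∈ A,
      β * A.card ≤ (A.filter (fun w => G.Adj v w)).card) :
    ∀ k : ℕ, ∀ A : Finset V, (1 - β) ^ k * A.card ≤ m →
      auxI G lam A ≤ (1 + lam) ^ m * (1 + A.card) ^ k := by
  have base : ∀ k : ℕ, ∀ A : Finset V, A.card ≤ m →
      auxI G lam A ≤ (1 + lam) ^ m * (1 + A.card) ^ k := by
    intro k A hA
    have h1 := auxI_le_base G lam hl A
    have h2 : (1 + lam) ^ A.card ≤ (1 + lam) ^ m := pow_le_pow_right₀ (by linarith) hA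
    have h3 : (1 : ℝ) ≤ (1 + A.card) ^ k := one_le_pow₀ (by
      have : (0 : ℝ) ≤ A.card := Nat.cast_nonneg _
      linarith)
    have h4 : (0 : ℝ) < (1 + lam) ^ m := by positivity
    nlinarith
  intro k
  induction k with
  | zero =>
    intro A hA
    rw [pow_zero, one_mul] at hA
    exact base 0 A (by exact_mod_cast hA)
  | succ k ihk =>
    intro A
    induction A using Finset.strongInduction with
    | H A ihA =>
      intro hA
      by_cases hAm : A.card ≤ m
      · exact base _ A hAm
      push Not at hAm
      obtain ⟨v, hv, hvd⟩ := hdeg A hAm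
      have hβ0 : 0 ≤ 1 - β := by linarith
      have hec : (A.erase v).card + 1 = A.card := Finset.card_erase_add_one hv
      have hecR : ((A.erase v).card : ℝ) + 1 = A.card := by exact_mod_cast hec
      have h1 := ihA (A.erase v) (Finset.erase_ssubset hv) (by
        refine le_trans ?_ hA
        gcongr
        exact Finset.erase_subset _ _)
      set C := (A.erase v).filter (fun w => ¬ G.Adj v w) with hC
      have hCc : (C.card : ℝ) ≤ (1 - β) * A.card := by
        have a : C.card ≤ (A.filter (fun w => ¬ G.Adj v w)).card :=
          Finset.card_le_card (Finset.filter_subset_filter _ (Finset.erase_subset _ _))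
        have b : (A.filter (fun w => G.Adj v w)).card + (A.filter (fun w => ¬ G.Adj v w)).card
          = A.card := Finset.card_filter_add_card_filter_not _
        have a' : (C.card : ℝ) ≤ ((A.filter (fun w => ¬ G.Adj v w)).card : ℝ) := by
          exact_mod_cast a
        have b' : ((A.filter (fun w => G.Adj v w)).card : ℝ)
          + ((A.filter (fun w => ¬ G.Adj v w)).card : ℝ) = A.card := by exact_mod_cast b
        linarith
      have h2 := ihk C (by
        refine le_trans ?_ hA
        rw [pow_succ, mul_assoc]
        gcongr)
      have h3 := auxI_rec G lam hl A v hv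
      rw [← hC] at h3
      have hCA : (C.card : ℝ) ≤ A.card := by
        exact_mod_cast Finset.card_le_card ((Finset.filter_subset _ _).trans (Finset.erase_subset _ _))
      have h0 : 0 ≤ auxI G lam C := by
        rw [auxI]
        apply Finset.sum_nonneg
        intro T _
        split_ifs <;> positivity
      set a : ℝ := (A.card : ℝ) with ha
      have hM : (0 : ℝ) < (1 + lam) ^ m := by positivity
      have ha0 : 0 ≤ a := by positivity
      calc auxI G lam A ≤ auxI G lam (A.erase v) + 1 * auxI G lam C := by
            refine h3.trans ?_
            gcongr
        _ ≤ (1 + lam) ^ m * a ^ (k + 1) + 1 * ((1 + lam) ^ m * (1 + a) ^ k) := by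
            have e1 : (1 : ℝ) + (A.erase v).card = a := by linarith
            rw [e1] at h1
            have e2 : (1 + lam) ^ m * (1 + (C.card : ℝ)) ^ k ≤ (1 + lam) ^ m * (1 + a) ^ k := by
              gcongr
            linarith
        _ ≤ (1 + lam) ^ m * (1 + a) ^ (k + 1) := by
            have e3 : a ^ k ≤ (1 + a) ^ k := by gcongr; linarith
            have e4 : a ^ (k + 1) ≤ (1 + a) ^ k * a := by rw [pow_succ]; gcongr
            have : a ^ (k + 1) + (1 + a) ^ k ≤ (1 + a) ^ (k + 1) := by
              rw [pow_succ (1 + a)]; linarith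
            nlinarith

open Classical in
/-- ordered edge count -/
noncomputable def auxD {V : Type*} (G : SimpleGraph V) (A : Finset V) : ℕ :=
  ∑ v ∈ A, (A.filter (fun w => G.Adj v w)).card

open Classical in
lemma auxD_erase {V : Type*} (G : SimpleGraph V) (A : Finset V) (v : V) (hv : v ∈ A) :
    auxD G A = auxD G (A.erase v) + 2 * (A.filter (fun w => G.Adj v w)).card := by
  have h1 : ∀ w ∈ A.erase v, (A.filter (fun x => G.Adj w x)).card =
      ((A.erase v).filter (fun x => G.Adj w x)).card + if G.Adj v w then 1 else 0 := by
    intro w hw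
    rw [Finset.filter_erase]
    by_cases h : G.Adj v w
    · rw [if_pos h, Finset.card_erase_add_one]
      exact Finset.mem_filter.2 ⟨hv, h.symm⟩
    · rw [if_neg h, Finset.erase_eq_of_notMem, add_zero]
      exact fun h' => h (Finset.mem_filter.1 h').2.symm
  rw [auxD, ← Finset.add_sum_erase _ _ hv, Finset.sum_congr rfl h1, Finset.sum_add_distrib, auxD,
    ← Finset.card_filter]
  have : ((A.erase v).filter (fun w => G.Adj v w)) = A.filter (fun w => G.Adj v w) := by
    rw [Finset.filter_erase, Finset.erase_eq_of_notMem]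
    exact fun h' => G.loopless.irrefl _ (Finset.mem_filter.1 h').2
  rw [this]
  ring

open Classical in
lemma auxD_avg {V : Type*} (G : SimpleGraph V) (m e : ℕ) (hm : 2 ≤ m)
    (h : ∀ A : Finset V, A.card = m → e ≤ auxD G A) :
    ∀ A : Finset V, m ≤ A.card →
      (e : ℝ) * (A.card * (A.card - 1)) ≤ auxD G A * (m * (m - 1)) := by
  intro A
  induction A using Finset.strongInduction with
  | H A ih =>
    intro hA
    rcases hA.eq_or_lt with hA' | hA'
    · rw [← hA']
      have : (e : ℝ) ≤ auxD G A := by exact_mod_cast h A hA'.symm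
      have hm' : (2 : ℝ) ≤ m := by exact_mod_cast hm
      exact mul_le_mul_of_nonneg_right this (by nlinarith)
    · set a := A.card with ha
      have haR : (m : ℝ) + 1 ≤ a := by exact_mod_cast hA'
      have hm' : (2 : ℝ) ≤ m := by exact_mod_cast hm
      have h1 : ∀ v ∈ A, (e : ℝ) * ((a - 1) * (a - 2)) ≤
          ((auxD G A : ℝ) - 2 * (A.filter (fun w => G.Adj v w)).card) * (m * (m - 1)) := by
        intro v hv
        have hc := Finset.card_erase_add_one hv
        have hcR : ((A.erase v).card : ℝ) = a - 1 := by
          have : ((A.erase v).card : ℝ) + 1 = a := by exact_mod_cast hc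
          linarith
        have h2 := ih (A.erase v) (Finset.erase_ssubset hv) (by omega)
        rw [hcR] at h2
        have h3 : (auxD G A : ℝ) = auxD G (A.erase v)
            + 2 * (A.filter (fun w => G.Adj v w)).card := by exact_mod_cast auxD_erase G A v hv
        calc _ = (e : ℝ) * ((a - 1) * (a - 1 - 1)) := by ring
          _ ≤ _ := h2
          _ = _ := by rw [h3]; ring
      have h4 := Finset.sum_le_sum h1
      rw [Finset.sum_const, nsmul_eq_mul, ← Finset.sum_mul, Finset.sum_sub_distrib,
        Finset.sum_const, nsmul_eq_mul, ← Finset.mul_sum] at h4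
      have h5 : ∑ v ∈ A, ((A.filter (fun w => G.Adj v w)).card : ℝ) = auxD G A := by
        rw [auxD]; push_cast; rfl
      rw [h5, ← ha] at h4
      have h6 : (0 : ℝ) < a - 2 := by linarith
      refine le_of_mul_le_mul_left ?_ h6
      nlinarith

open Classical in
lemma aux_sample {V : Type*} [Fintype V] (F : Finset (Finset V)) (t q : ℕ) (hq : 0 < q)
    (hF : ∀ T ∈ F, T.card = t) (hc : (F.card : ℝ) * q < (q : ℝ) ^ t) :
    ∃ W : Finset V, Fintype.card V ≤ q * W.card ∧ ∀ T ∈ F, ¬ T ⊆ W := by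
  by_contra hcon
  push Not at hcon
  have hmono : ∀ χ : V → Fin q, ∃ T ∈ F, ∃ i, ∀ l ∈ T, χ l = i := by
    intro χ
    have : Nonempty (Fin q) := ⟨⟨0, hq⟩⟩
    have : ∃ i : Fin q, Fintype.card V ≤ q * (Finset.univ.filter (fun l => χ l = i)).card := by
      by_contra hno
      push Not at hno
      have e1 : Fintype.card V = ∑ i : Fin q, (Finset.univ.filter (fun l => χ l = i)).card := by
        rw [← Finset.card_univ]
        exact Finset.card_eq_sum_card_fiberwise (fun _ _ => Finset.mem_univ _)
      have e2 : ∑ i : Fin q, q * (Finset.univ.filter (fun l => χ l = i)).card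
          < ∑ i : Fin q, Fintype.card V :=
        Finset.sum_lt_sum_of_nonempty Finset.univ_nonempty (fun i _ => hno i)
      rw [← Finset.mul_sum, ← e1] at e2
      simp at e2
    obtain ⟨i, hi⟩ := this
    obtain ⟨T, hT, hTi⟩ := hcon _ hi
    exact ⟨T, hT, i, fun l hl => (Finset.mem_filter.1 (hTi hl)).2⟩
  have hcov : (Finset.univ : Finset (V → Fin q)) ⊆
      (F ×ˢ (Finset.univ : Finset (Fin q))).biUnion (fun Ti =>
        Fintype.piFinset (fun l => if l ∈ Ti.1 then {Ti.2} else Finset.univ)) := by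
    intro χ _
    obtain ⟨T, hT, i, hi⟩ := hmono χ
    rw [Finset.mem_biUnion]
    refine ⟨(T, i), by simp [hT], ?_⟩
    rw [Fintype.mem_piFinset]
    intro l
    by_cases hl : l ∈ T
    · simp [hl, hi l hl]
    · simp [hl]
  have h1 := (Finset.card_le_card hcov).trans Finset.card_biUnion_le
  have h2 : ∀ Ti ∈ F ×ˢ (Finset.univ : Finset (Fin q)),
      (Fintype.piFinset (fun l => if l ∈ Ti.1 then ({Ti.2} : Finset (Fin q)) else Finset.univ)).card
        = q ^ (Fintype.card V - t) := by
    intro Ti hTi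
    rw [Fintype.card_piFinset]
    have : ∀ l, (if l ∈ Ti.1 then ({Ti.2} : Finset (Fin q)) else Finset.univ).card
        = if l ∈ Ti.1 then 1 else q := by
      intro l; split_ifs <;> simp
    simp_rw [this]
    rw [Finset.prod_ite, Finset.prod_const_one, one_mul, Finset.prod_const]
    congr 1
    rw [← hF Ti.1 (Finset.mem_product.1 hTi).1, ← Finset.card_compl]
    congr 1
    ext l; simp
  rw [Finset.sum_congr rfl h2, Finset.sum_const, Finset.card_product] at h1
  simp only [Finset.card_univ, Fintype.card_fun, Fintype.card_fin, smul_eq_mul] at h1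
  have ht : t ≤ Fintype.card V := by
    obtain ⟨T, hT, -⟩ := hmono (fun _ => ⟨0, hq⟩)
    rw [← hF T hT]
    exact Finset.card_le_univ T
  have h3 : (q : ℝ) ^ t * q ^ (Fintype.card V - t) ≤ F.card * q * q ^ (Fintype.card V - t) := by
    rw [← pow_add, Nat.add_sub_cancel' ht]
    exact_mod_cast h1
  have hqR : (0 : ℝ) < q := by exact_mod_cast hq
  have := le_of_mul_le_mul_right h3 (by positivity)
  linarith
open Classical in
lemma aux_lower {P L : Type} [Fintype P] [Fintype L] (inc : L → Finset P) (j q : ℕ)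
    (hqj : q = 2 ^ j) (hj : 20 * j < q) (hj1 : 1 ≤ j)
    (hq : ∀ l, q ≤ (inc l).card) (hP : Fintype.card P ≤ q ^ 3) (hL : Fintype.card L ≤ q ^ 4)
    (hlin : ∀ l l', l ≠ l' → ∀ p p', p ∈ inc l → p ∈ inc l' → p' ∈ inc l → p' ∈ inc l' → p = p')
    (honan : ∀ l1 l2 l3 l4 : L, ∀ p12 p13 p14 p23 p24 p34 : P,
      p12 ∈ inc l1 → p12 ∈ inc l2 → p13 ∈ inc l1 → p13 ∈ inc l3 → p14 ∈ inc l1 → p14 ∈ inc l4 →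
      p23 ∈ inc l2 → p23 ∈ inc l3 → p24 ∈ inc l2 → p24 ∈ inc l4 → p34 ∈ inc l3 → p34 ∈ inc l4 →
      p12 ∉ inc l3 → p12 ∉ inc l4 → p13 ∉ inc l4 → p23 ∉ inc l4 → p23 ∉ inc l1 → False) :
    ∃ (W : Finset L) (H : SimpleGraph W),
      (∀ a b c d, H.Adj a b → H.Adj a c → H.Adj a d → H.Adj b c → H.Adj b d → H.Adj c d → False) ∧
      (∀ T : Finset W, T.card = 2000 * q * j ^ 2 → ¬ H.IsIndependent T) ∧
      Fintype.card L ≤ q * W.card := by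
  obtain ⟨c, hc⟩ := aux_color inc j q hqj hj hq hP hL
  set m := 10 * q ^ 2 with hm
  have hq20 : 20 < q := by omega
  obtain ⟨G, hAdj⟩ : ∃ G : SimpleGraph L, ∀ l l', G.Adj l l' ↔
      ∃ p, p ∈ inc l ∧ p ∈ inc l' ∧ c p l ≠ c p l' :=
    ⟨{ Adj := fun l l' => ∃ p, p ∈ inc l ∧ p ∈ inc l' ∧ c p l ≠ c p l'
       symm := ⟨fun l l' ⟨p, h1, h2, h3⟩ => ⟨p, h2, h1, h3.symm⟩⟩
       loopless := ⟨fun l ⟨p, h1, h2, h3⟩ => h3 rfl⟩ }, fun _ _ => Iff.rfl⟩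
  -- edge count
  have hD : ∀ X : Finset L, X.card = m → q ^ 3 ≤ auxD G X := by
    intro X hX
    refine (hc X hX).le.trans ?_
    have e1 : auxD G X = ((X ×ˢ X).filter (fun z => G.Adj z.1 z.2)).card := by
      rw [auxD, Finset.card_filter, Finset.sum_product]
      apply Finset.sum_congr rfl
      intro l _
      rw [Finset.card_filter]
    have e2 : auxE inc X c = (Finset.univ.biUnion (fun p : P =>
        (X.filter (fun l => p ∈ inc l ∧ c p l = true)) ×ˢ
        (X.filter (fun l => p ∈ inc l ∧ c p l = false)))).card := by
      rw [Finset.card_biUnion, auxE]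
      · apply Finset.sum_congr rfl
        intro p _
        rw [Finset.card_product]
      · intro p _ p' _ hpp
        rw [Function.onFun, Finset.disjoint_left]
        rintro ⟨l, l'⟩ h1 h2
        simp only [Finset.mem_product, Finset.mem_filter] at h1 h2
        apply hpp
        refine hlin l l' ?_ p p' h1.1.2.1 h1.2.2.1 h2.1.2.1 h2.2.2.1
        rintro rfl
        have := h1.1.2.2
        rw [h1.2.2.2] at this
        exact absurd this (by simp)
    rw [e1, e2]
    apply Finset.card_le_card
    rintro ⟨l, l'⟩ h
    simp only [Finset.mem_biUnion, Finset.mem_product, Finset.mem_filter, Finset.mem_univ,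
      true_and] at h ⊢
    obtain ⟨p, h1, h2⟩ := h
    exact ⟨⟨h1.1, h2.1⟩, (hAdj _ _).2 ⟨p, h1.2.1, h2.2.1, by rw [h1.2.2, h2.2.2]; simp⟩⟩
  have hqR : (20 : ℝ) < q := by exact_mod_cast hq20
  have hmR : (m : ℝ) = 10 * q ^ 2 := by rw [hm]; push_cast; ring
  have hdeg : ∀ A : Finset L, m < A.card → ∃ v ∈ A,
      (1 / (100 * q) : ℝ) * A.card ≤ (A.filter (fun w => G.Adj v w)).card := by
    intro A hA
    by_contra hcon
    push Not at hcon
    have h1 := auxD_avg G m (q ^ 3) (by nlinarith) hD A hA.le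
    have h2 : (auxD G A : ℝ) ≤ A.card * ((1 / (100 * q) : ℝ) * A.card) := by
      rw [auxD]
      push_cast
      rw [← nsmul_eq_mul]
      exact Finset.sum_le_card_nsmul _ _ _ (fun v hv => (hcon v hv).le)
    have hAR : (m : ℝ) < A.card := by exact_mod_cast hA
    set a : ℝ := (A.card : ℝ) with ha
    have hm1 : (1 : ℝ) < m := by rw [hmR]; nlinarith
    have hmm : (0 : ℝ) < m * (m - 1) := by nlinarith
    have h3 := h1.trans (mul_le_mul_of_nonneg_right h2 hmm.le)
    push_cast at h3
    have h4 : a * ((1 / (100 * q) : ℝ) * a) * (m * (m - 1)) = (q : ℝ) ^ 3 * a * (a * (m - 1) / m) := by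
      rw [hmR]
      field_simp
      ring
    rw [h4, mul_assoc] at h3
    have ha0 : 0 < a := by linarith
    have h5 := le_of_mul_le_mul_left h3 (by positivity)
    have h6 := le_of_mul_le_mul_left h5 ha0
    rw [le_div_iff₀ (by linarith)] at h6
    nlinarith
  set t := 2000 * q * j ^ 2 with ht
  set k := 400 * q * j with hk
  clear_value t k
  have hlam : (4 / q : ℝ) ≤ 1 := by rw [div_le_one (by linarith)]; linarith
  have hβ : (1 / (100 * q) : ℝ) ≤ 1 := by rw [div_le_one (by linarith)]; linarith
  have hexp : Real.exp (-1) ≤ 1 / 2 := by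
    rw [Real.exp_neg, one_div]
    have := Real.add_one_le_exp 1
    exact inv_anti₀ (by norm_num) (by linarith)
  have hLR : (Fintype.card L : ℝ) ≤ 2 ^ (4 * j) := by
    have : (q ^ 4) = 2 ^ (4 * j) := by rw [hqj, ← pow_mul]; congr 1; ring
    rw [this] at hL
    exact_mod_cast hL
  have hkw := aux_kw G (4 / q) (by positivity) hlam m (1 / (100 * q)) hβ hdeg k Finset.univ (by
    rw [Finset.card_univ]
    have h1 : (1 - 1 / (100 * q) : ℝ) ^ k ≤ (1 / 2) ^ (4 * j) := by
      calc (1 - 1 / (100 * q) : ℝ) ^ k ≤ (Real.exp (-(1 / (100 * q)))) ^ k := by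
            apply pow_le_pow_left₀ (by linarith)
            exact Real.one_sub_le_exp_neg _
        _ = (Real.exp (-1)) ^ (4 * j) := by
            rw [← Real.exp_nat_mul, ← Real.exp_nat_mul]
            congr 1
            rw [hk]
            push_cast
            field_simp
            ring
        _ ≤ _ := pow_le_pow_left₀ (Real.exp_pos _).le hexp _
    calc (1 - 1 / (100 * q) : ℝ) ^ k * (Fintype.card L : ℝ)
        ≤ (1 / 2) ^ (4 * j) * 2 ^ (4 * j) := by gcongr
      _ = 1 := by rw [← mul_pow]; norm_num
      _ ≤ m := by rw [hmR]; nlinarith)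
  set F := (Finset.powersetCard t (Finset.univ : Finset L)).filter (fun T => G.IsIndependent T)
    with hF
  have hF1 : (F.card : ℝ) * (4 / q) ^ t ≤ auxI G (4 / q) Finset.univ := by
    have hsub : F ⊆ (Finset.univ : Finset L).powerset := by
      intro T _; simp
    rw [auxI]
    refine le_trans ?_ (Finset.sum_le_sum_of_subset_of_nonneg hsub (fun T _ _ => by
      split_ifs <;> positivity))
    rw [← nsmul_eq_mul]
    apply Finset.card_nsmul_le_sum
    intro T hT
    obtain ⟨h1, h2⟩ := Finset.mem_filter.1 hT
    rw [if_pos h2, (Finset.mem_powersetCard.1 h1).2]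
  have hbound : (1 + 4 / q : ℝ) ^ m * (1 + (Finset.univ : Finset L).card) ^ k
      ≤ 2 ^ (80 * q + (4 * j + 1) * k) := by
    rw [pow_add]
    have h1 : (1 + 4 / q : ℝ) ^ m ≤ 2 ^ (80 * q) := by
      calc (1 + 4 / q : ℝ) ^ m ≤ (Real.exp (4 / q)) ^ m := by
            apply pow_le_pow_left₀ (by positivity)
            rw [add_comm]
            exact Real.add_one_le_exp _
        _ = (Real.exp 1) ^ (40 * q) := by
            rw [← Real.exp_nat_mul, ← Real.exp_nat_mul]
            congr 1
            rw [hmR]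
            push_cast
            field_simp
            ring
        _ ≤ ((2 : ℝ) ^ 2) ^ (40 * q) := by
            apply pow_le_pow_left₀ (Real.exp_pos _).le
            have := Real.exp_one_lt_d9
            linarith
        _ = _ := by rw [← pow_mul]; congr 1; ring
    have h2 : (1 + (Finset.univ : Finset L).card : ℝ) ^ k ≤ 2 ^ ((4 * j + 1) * k) := by
      rw [pow_mul]
      apply pow_le_pow_left₀ (by positivity)
      rw [Finset.card_univ, pow_succ]
      have : (1 : ℝ) ≤ 2 ^ (4 * j) := one_le_pow₀ (by norm_num)
      linarith
    gcongr
  have hlt : (F.card : ℝ) * q < (q : ℝ) ^ t := by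
    have h1 := (hF1.trans hkw).trans hbound
    rw [div_pow, mul_div_assoc', div_le_iff₀ (by positivity)] at h1
    have h2 : (2 : ℝ) ^ (80 * q + (4 * j + 1) * k) * q < 4 ^ t := by
      have e : (q : ℝ) = 2 ^ j := by rw [hqj]; push_cast; rfl
      have e4 : (4 : ℝ) ^ t = 2 ^ (2 * t) := by rw [pow_mul]; norm_num
      rw [e4]
      calc (2 : ℝ) ^ (80 * q + (4 * j + 1) * k) * q
          = 2 ^ (80 * q + (4 * j + 1) * k + j) := by rw [pow_add _ _ j, ← e]
        _ < _ := by
          apply pow_lt_pow_right₀ (by norm_num)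
          have a1 : q * j ≤ q * j ^ 2 := Nat.mul_le_mul_left _ (by nlinarith)
          have a2 : q ≤ q * j := Nat.le_mul_of_pos_right _ hj1
          have a3 : j ≤ q * j := Nat.le_mul_of_pos_left _ (by omega)
          have a4 : (4 * j + 1) * k = 1600 * (q * j ^ 2) + 400 * (q * j) := by rw [hk]; ring
          have a5 : 2 * t = 4000 * (q * j ^ 2) := by rw [ht]; ring
          omega
    have h3 : (F.card : ℝ) * q * 4 ^ t < q ^ t * 4 ^ t := by
      calc (F.card : ℝ) * q * 4 ^ t = (F.card * 4 ^ t) * q := by ring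
        _ ≤ (2 ^ (80 * q + (4 * j + 1) * k) * q ^ t) * q := by gcongr
        _ = q ^ t * (2 ^ (80 * q + (4 * j + 1) * k) * q) := by ring
        _ < _ := by
          apply mul_lt_mul_of_pos_left h2
          positivity
    exact lt_of_mul_lt_mul_right h3 (by positivity)
  obtain ⟨W, hW1, hW2⟩ := aux_sample F t q (by omega)
    (fun T hT => (Finset.mem_powersetCard.1 (Finset.mem_filter.1 hT).1).2) hlt
  have hconc : ∀ l l' l'' p, G.Adj l l' → G.Adj l l'' → G.Adj l' l'' → p ∈ inc l → p ∈ inc l' →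
      p ∉ inc l'' := by
    intro l l' l'' p h1 h2 h3 m1 m2 m3
    have key : ∀ a b, G.Adj a b → p ∈ inc a → p ∈ inc b → c p a ≠ c p b := by
      intro a b hab ma mb
      obtain ⟨p', u1, u2, u3⟩ := (hAdj a b).1 hab
      have := hlin a b hab.ne p p' ma mb u1 u2
      rw [this]; exact u3
    have k1 := key _ _ h1 m1 m2
    have k2 := key _ _ h2 m1 m3
    have k3 := key _ _ h3 m2 m3
    revert k1 k2 k3
    cases c p l <;> cases c p l' <;> cases c p l'' <;> simp
  refine ⟨W, G.comap Subtype.val, ?_, ?_, hW1⟩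
  · intro a b c' d hab hac had hbc hbd hcd
    simp only [SimpleGraph.comap_adj] at hab hac had hbc hbd hcd
    obtain ⟨p12, u1, u2, -⟩ := (hAdj _ _).1 hab
    obtain ⟨p13, u3, u4, -⟩ := (hAdj _ _).1 hac
    obtain ⟨p14, u5, u6, -⟩ := (hAdj _ _).1 had
    obtain ⟨p23, u7, u8, -⟩ := (hAdj _ _).1 hbc
    obtain ⟨p24, u9, u10, -⟩ := (hAdj _ _).1 hbd
    obtain ⟨p34, u11, u12, -⟩ := (hAdj _ _).1 hcd
    exact honan _ _ _ _ p12 p13 p14 p23 p24 p34 u1 u2 u3 u4 u5 u6 u7 u8 u9 u10 u11 u12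
      (hconc _ _ _ _ hab hac hbc u1 u2) (hconc _ _ _ _ hab had hbd u1 u2)
      (hconc _ _ _ _ hac had hcd u3 u4) (hconc _ _ _ _ hbc hbd hcd u7 u8)
      (hconc _ _ _ _ hbc hab.symm hac.symm u7 u8)
  · intro T hT hTi
    refine hW2 (T.map ⟨Subtype.val, Subtype.val_injective⟩) ?_ ?_
    · rw [hF, Finset.mem_filter, Finset.mem_powersetCard]
      refine ⟨⟨Finset.subset_univ _, by rw [Finset.card_map, hT]⟩, ?_⟩
      intro x hx y hy
      simp only [Finset.mem_map, Function.Embedding.coeFn_mk] at hx hy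
      obtain ⟨x, hx, rfl⟩ := hx
      obtain ⟨y, hy, rfl⟩ := hy
      exact hTi x hx y hy
    · intro x hx
      simp only [Finset.mem_map, Function.Embedding.coeFn_mk] at hx
      obtain ⟨x, hx, rfl⟩ := hx
      exact x.2
lemma aux_side {F : Type*} [Field F] (σ : F →+* F) (xA yA xB yB x y a b a4 b4 : F)
    (hA : yA + σ yA = xA * σ xA) (hB : yB + σ yB = xB * σ xB) (hQ : y + σ y = x * σ x)
    (lA : yA = a * xA + b) (lB : yB = a * xB + b) (lQ : y = a * x + b) (l4 : y = a4 * x + b4) :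
    (yB - a4 * xB - b4) * σ (yA - a4 * xA - b4) * (yA + σ yB - xA * σ xB)
      + (yA - a4 * xA - b4) * σ (yB - a4 * xB - b4) * (yB + σ yA - xB * σ xA) = 0 := by
  set f := yA - a4 * xA - b4 with hf
  set g := yB - a4 * xB - b4 with hg
  have e1 : (g - f) * x = g * xA - f * xB := by
    have h : (a - a4) * x + (b - b4) = 0 := by linear_combination l4 - lQ
    have hf' : f = (a - a4) * xA + (b - b4) := by rw [hf, lA]; ring
    have hg' : g = (a - a4) * xB + (b - b4) := by rw [hg, lB]; ring
    rw [hf', hg']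
    linear_combination (xB - xA) * h
  have e2 : (g - f) * y = g * yA - f * yB := by
    rw [lA, lB, lQ]
    linear_combination a * e1
  have E1 := congrArg σ e1
  have E2 := congrArg σ e2
  simp only [map_sub, map_mul] at E1 E2
  generalize σ f = sf at *
  generalize σ g = sg at *
  generalize σ x = sx at *
  generalize σ y = sy at *
  generalize σ xA = sxA at *
  generalize σ yA = syA at *
  generalize σ xB = sxB at *
  generalize σ yB = syB at *
  clear hf hg lA lB lQ l4
  clear_value f g
  linear_combination (-(g - f) * (sg - sf)) * hQ + (sg - sf) * e2 + (g - f) * E2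
    - (sg - sf) * sx * e1 - (g * xA - f * xB) * E1 + g * sg * hA + f * sf * hB

lemma aux_onan {F : Type*} [Field F] (σ : F →+* F) (xA yA xB yB xC yC x1 y1 x2 y2 x3 y3 : F)
    (a1 b1 a2 b2 a3 b3 a4 b4 : F)
    (hA : yA + σ yA = xA * σ xA) (hB : yB + σ yB = xB * σ xB) (hC : yC + σ yC = xC * σ xC)
    (h1 : y1 + σ y1 = x1 * σ x1) (h2 : y2 + σ y2 = x2 * σ x2) (h3 : y3 + σ y3 = x3 * σ x3)
    (lA1 : yA = a1 * xA + b1) (lA2 : yA = a2 * xA + b2)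
    (lB1 : yB = a1 * xB + b1) (lB3 : yB = a3 * xB + b3)
    (lC2 : yC = a2 * xC + b2) (lC3 : yC = a3 * xC + b3)
    (l11 : y1 = a1 * x1 + b1) (l14 : y1 = a4 * x1 + b4)
    (l22 : y2 = a2 * x2 + b2) (l24 : y2 = a4 * x2 + b4)
    (l33 : y3 = a3 * x3 + b3) (l34 : y3 = a4 * x3 + b4)
    (nA3 : yA ≠ a3 * xA + b3) (nA4 : yA ≠ a4 * xA + b4) (nB4 : yB ≠ a4 * xB + b4)
    (nC4 : yC ≠ a4 * xC + b4) (nC1 : yC ≠ a1 * xC + b1) : False := by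
  have s1 := aux_side σ xA yA xB yB x1 y1 a1 b1 a4 b4 hA hB h1 lA1 lB1 l11 l14
  have s2 := aux_side σ xB yB xC yC x3 y3 a3 b3 a4 b4 hB hC h3 lB3 lC3 l33 l34
  have s3 := aux_side σ xC yC xA yA x2 y2 a2 b2 a4 b4 hC hA h2 lC2 lA2 l22 l24
  have fA : yA - a4 * xA - b4 ≠ 0 := fun h => nA4 (by linear_combination h)
  have fB : yB - a4 * xB - b4 ≠ 0 := fun h => nB4 (by linear_combination h)
  have fC : yC - a4 * xC - b4 ≠ 0 := fun h => nC4 (by linear_combination h)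
  have gA : σ (yA - a4 * xA - b4) ≠ 0 := (map_ne_zero σ).2 fA
  have gB : σ (yB - a4 * xB - b4) ≠ 0 := (map_ne_zero σ).2 fB
  have gC : σ (yC - a4 * xC - b4) ≠ 0 := (map_ne_zero σ).2 fC
  generalize yA - a4 * xA - b4 = fA' at *
  generalize yB - a4 * xB - b4 = fB' at *
  generalize yC - a4 * xC - b4 = fC' at *
  generalize σ fA' = gA' at *
  generalize σ fB' = gB' at *
  generalize σ fC' = gC' at *
  set hAB := yA + σ yB - xA * σ xB with dAB
  set hBA := yB + σ yA - xB * σ xA with dBA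
  set hBC := yB + σ yC - xB * σ xC with dBC
  set hCB := yC + σ yB - xC * σ xB with dCB
  set hCA := yC + σ yA - xC * σ xA with dCA
  set hAC := yA + σ yC - xA * σ xC with dAC
  have hprod : (fA' * fB' * fC' * gA' * gB' * gC') * (hAB * hBC * hCA + hBA * hCB * hAC) = 0 := by
    linear_combination (fC' * gB' * hBC) * (fA' * gC' * hCA) * s1
      - (fA' * gB' * hBA) * (fA' * gC' * hCA) * s2
      + (fA' * gB' * hBA) * (fB' * gC' * hCB) * s3
  have hcyc : hAB * hBC * hCA + hBA * hCB * hAC = 0 := by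
    refine (mul_eq_zero.1 hprod).resolve_left ?_
    simp [fA, fB, fC, gA, gB, gC]
  set D := xA * (yB - yC) - yA * (xB - xC) + (xB * yC - yB * xC) with hD
  have hDD : D * σ D = 0 := by
    simp only [hD, map_add, map_sub, map_mul]
    rw [dAB, dBA, dBC, dCB, dCA, dAC] at hcyc
    clear_value D hAB hBA hBC hCB hCA hAC
    clear s1 s2 s3 hprod
    generalize σ xA = sxA at *
    generalize σ yA = syA at *
    generalize σ xB = sxB at *
    generalize σ yB = syB at *
    generalize σ xC = sxC at *
    generalize σ yC = syC at *
    linear_combination hcyc - ((yB + syC - xB * sxC) * (yC + syB - xC * sxB)) * hA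
      - ((yA + syC - xA * sxC) * (yC + syA - xC * sxA)) * hB
      - ((yA + syB - xA * sxB) * (yB + syA - xB * sxA)) * hC
      + (yB + syB - xB * sxB) * (yC + syC - xC * sxC) * hA
  have hD0 : D = 0 := by
    rcases mul_eq_zero.1 hDD with h | h
    · exact h
    · exact (map_eq_zero σ).1 h
  have hx : xA ≠ xB := by
    intro h
    apply nA3
    have : yA = yB := by rw [lA1, lB1, h]
    rw [this, h]; exact lB3
  have : (xB - xA) * (yC - a1 * xC - b1) = 0 := by
    have e : D = (xB - xA) * (yC - a1 * xC - b1) := by rw [hD, lA1, lB1]; ring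
    rw [← e]; exact hD0
  rcases mul_eq_zero.1 this with h | h
  · exact hx (by linear_combination -h)
  · exact nC1 (by linear_combination h)

open Classical in
lemma aux_tr {F : Type} [Field F] [Fintype F] (q : ℕ) (hq : 2 ≤ q) (c : F) :
    (Finset.univ.filter (fun y : F => y + y ^ q = c)).card ≤ q := by
  open Polynomial in
  set p : F[X] := X ^ q + (X - C c) with hp
  have hdeg : (X - C c : F[X]).degree < q := by
    rw [degree_X_sub_C]
    exact_mod_cast hq
  have hd : p.natDegree = q := by
    apply natDegree_eq_of_degree_eq_some
    rw [hp, degree_add_eq_left_of_degree_lt]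
    · simp
    · rw [degree_X_pow]; exact hdeg
  have hp0 : p ≠ 0 := by
    intro h
    rw [h] at hd
    simp at hd
    omega
  calc _ ≤ p.roots.toFinset.card := by
        apply Finset.card_le_card
        intro y hy
        rw [Finset.mem_filter] at hy
        rw [Multiset.mem_toFinset, mem_roots hp0, IsRoot, hp]
        simp only [eval_add, eval_pow, eval_X, eval_sub, eval_C]
        rw [← hy.2]
        ring
    _ ≤ Multiset.card p.roots := Multiset.toFinset_card_le _
    _ ≤ p.natDegree := card_roots' _
    _ = q := hd

open Classical in
lemma aux_norm {F : Type} [Field F] [Fintype F] (q : ℕ) (hq : 2 ≤ q) (hF : Fintype.card F = q ^ 2)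
    (c : F) (hc : c ≠ 0) (hcq : c ^ q = c) :
    q ≤ (Finset.univ.filter (fun u : F => u * u ^ q = c)).card := by
  have hU : Nat.card Fˣ = (q - 1) * (q + 1) := by
    rw [Nat.card_eq_fintype_card, Fintype.card_units, hF]
    obtain ⟨k, rfl⟩ : ∃ k, q = k + 1 := ⟨q - 1, by omega⟩
    simp only [Nat.add_sub_cancel]
    rw [Nat.sub_eq_iff_eq_add (Nat.one_le_iff_ne_zero.2 (by positivity))]
    ring
  have hk1 : Nat.card (powMonoidHom (q - 1) : Fˣ →* Fˣ).ker = q - 1 := by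
    rw [IsCyclic.card_powMonoidHom_ker, hU]
    exact Nat.gcd_eq_right (Dvd.intro _ rfl)
  have hk2 : Nat.card (powMonoidHom (q + 1) : Fˣ →* Fˣ).ker = q + 1 := by
    rw [IsCyclic.card_powMonoidHom_ker, hU]
    exact Nat.gcd_eq_right (Dvd.intro_left _ rfl)
  have hr : Nat.card (powMonoidHom (q + 1) : Fˣ →* Fˣ).range = q - 1 := by
    rw [IsCyclic.card_powMonoidHom_range, hU, Nat.gcd_eq_right (Dvd.intro_left _ rfl)]
    exact Nat.mul_div_cancel _ (by omega)
  have hle : (powMonoidHom (q + 1) : Fˣ →* Fˣ).range ≤ (powMonoidHom (q - 1) : Fˣ →* Fˣ).ker := by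
    rintro _ ⟨u, rfl⟩
    rw [MonoidHom.mem_ker]
    simp only [powMonoidHom_apply]
    rw [← pow_mul, mul_comm, ← hU]
    exact pow_card_eq_one'
  have heq := Subgroup.eq_of_le_of_card_ge hle (by rw [hk1, hr])
  have hcm : Units.mk0 c hc ∈ (powMonoidHom (q + 1) : Fˣ →* Fˣ).range := by
    rw [heq, MonoidHom.mem_ker, powMonoidHom_apply]
    ext
    simp only [Units.val_pow_eq_pow_val, Units.val_mk0, Units.val_one]
    have : c ^ (q - 1) * c = 1 * c := by rw [← pow_succ, one_mul, Nat.sub_add_cancel (by omega), hcq]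
    exact mul_right_cancel₀ hc this
  obtain ⟨u0, hu0⟩ := hcm
  have hu1 : (u0 : F) ^ (q + 1) = c := by
    have := congrArg Units.val hu0
    simpa using this
  have : q + 1 ≤ (Finset.univ.filter (fun u : F => u * u ^ q = c)).card := by
    rw [← hk2, Nat.card_eq_fintype_card, ← Finset.card_univ]
    apply Finset.card_le_card_of_injOn (fun v => ((u0 * v.1 : Fˣ) : F))
    · intro v _
      have hv := v.2
      rw [MonoidHom.mem_ker, powMonoidHom_apply] at hv
      have hv' : ((v.1 : Fˣ) : F) ^ (q + 1) = 1 := by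
        have := congrArg Units.val hv
        simpa using this
      simp only [Finset.coe_filter, Finset.mem_univ, true_and, Set.mem_ofPred_eq]
      rw [← pow_succ', Units.val_mul, mul_pow, hu1, hv', mul_one]
    · intro v _ w _ h
      have h' := Units.ext h
      exact Subtype.ext (mul_left_cancel h')
  omega

open Classical in
lemma aux_unital (j q : ℕ) (hqj : q = 2 ^ j) (hj1 : 1 ≤ j) :
    ∃ (P L : Type) (_ : Fintype P) (_ : Fintype L) (inc : L → Finset P),
    (∀ l, q ≤ (inc l).card) ∧ (Fintype.card P ≤ q ^ 3) ∧ (Fintype.card L ≤ q ^ 4) ∧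
    (∀ l l', l ≠ l' → ∀ p p', p ∈ inc l → p ∈ inc l' → p' ∈ inc l → p' ∈ inc l' → p = p') ∧
    (∀ l1 l2 l3 l4 : L, ∀ p12 p13 p14 p23 p24 p34 : P,
      p12 ∈ inc l1 → p12 ∈ inc l2 → p13 ∈ inc l1 → p13 ∈ inc l3 → p14 ∈ inc l1 → p14 ∈ inc l4 →
      p23 ∈ inc l2 → p23 ∈ inc l3 → p24 ∈ inc l2 → p24 ∈ inc l4 → p34 ∈ inc l3 → p34 ∈ inc l4 →
      p12 ∉ inc l3 → p12 ∉ inc l4 → p13 ∉ inc l4 → p23 ∉ inc l4 → p23 ∉ inc l1 → False) ∧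
    q ^ 4 ≤ Fintype.card L + q ^ 3 := by
  have hq2 : 2 ≤ q := by
    rw [hqj]
    calc 2 = 2 ^ 1 := rfl
      _ ≤ 2 ^ j := Nat.pow_le_pow_right (by norm_num) hj1
  obtain ⟨F, iF, iFt, iC, hF⟩ : ∃ (F : Type) (_ : Field F) (_ : Fintype F) (_ : CharP F 2),
      Fintype.card F = q ^ 2 := by
    have : Fact (Nat.Prime 2) := ⟨Nat.prime_two⟩
    have : Fintype (GaloisField 2 (2 * j)) := Fintype.ofFinite _
    refine ⟨GaloisField 2 (2 * j), inferInstance, inferInstance, inferInstance, ?_⟩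
    rw [← Nat.card_eq_fintype_card, GaloisField.card 2 (2 * j) (by omega), hqj, ← pow_mul,
      mul_comm]
  have : Fact (Nat.Prime 2) := ⟨Nat.prime_two⟩
  have : ExpChar F 2 := ExpChar.prime Nat.prime_two
  obtain ⟨σ, hσ⟩ : ∃ σ : F →+* F, ∀ x, σ x = x ^ q :=
    ⟨iterateFrobenius F 2 j, fun x => by rw [iterateFrobenius_def, hqj]⟩
  have hσσ : ∀ x, σ (σ x) = x := by
    intro x
    rw [hσ, hσ, ← pow_mul, ← sq, ← hF, FiniteField.pow_card]
  have h2 : ∀ x : F, x + x = 0 := fun x => CharTwo.add_self_eq_zero x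
  let P := {z : F × F // z.2 + σ z.2 = z.1 * σ z.1}
  let L := {z : F × F // z.2 + σ z.2 + z.1 * σ z.1 ≠ 0}
  have hcnt : ∀ f : F → F, (Finset.univ.filter (fun z : F × F => z.2 + σ z.2 = f z.1)).card
      ≤ q ^ 3 := by
    intro f
    have : Finset.univ.filter (fun z : F × F => z.2 + σ z.2 = f z.1) =
        Finset.univ.biUnion (fun x : F =>
          (Finset.univ.filter (fun y : F => y + y ^ q = f x)).image (fun y => (x, y))) := by
      ext ⟨x, y⟩
      simp [hσ]
    rw [this]
    refine Finset.card_biUnion_le.trans ?_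
    calc _ ≤ ∑ x : F, q := Finset.sum_le_sum (fun x _ =>
            Finset.card_image_le.trans (aux_tr q hq2 _))
      _ = q ^ 3 := by
        rw [Finset.sum_const, Finset.card_univ, hF, smul_eq_mul]; ring
  have hFF : Fintype.card (F × F) = q ^ 4 := by
    rw [Fintype.card_prod, hF]; ring
  refine ⟨P, L, inferInstance, inferInstance,
    fun l => Finset.univ.filter (fun p : P => p.1.2 = l.1.1 * p.1.1 + l.1.2), ?_, ?_, ?_, ?_, ?_, ?_⟩
  · rintro ⟨⟨a, b⟩, hl⟩
    set c := b + σ b + a * σ a with hc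
    have hcq : c ^ q = c := by
      rw [← hσ, hc]
      simp only [map_add, map_mul, hσσ]
      ring
    refine (aux_norm q hq2 hF c hl hcq).trans ?_
    have key : ∀ u : F, u * u ^ q = c → (a * (u + σ a) + b) + σ (a * (u + σ a) + b)
        = (u + σ a) * σ (u + σ a) := by
      intro u hu
      rw [← hσ] at hu
      simp only [map_add, map_mul, hσσ]
      linear_combination -hu - hc
    refine Finset.card_le_card_of_injOn
      (fun u => if h : u * u ^ q = c then (⟨(u + σ a, a * (u + σ a) + b), key u h⟩ : P) else
        ⟨(0, 0), by simp⟩) ?_ ?_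
    · intro u hu
      simp only [Finset.coe_filter, Finset.mem_univ, true_and, Set.mem_ofPred_eq] at hu ⊢
      rw [dif_pos hu]
    · intro u hu v hv h
      simp only [Finset.coe_filter, Finset.mem_univ, true_and, Set.mem_ofPred_eq] at hu hv
      simp only [dif_pos hu, dif_pos hv] at h
      have := congrArg (fun p : P => p.1.1) h
      simpa using this
  · rw [Fintype.card_subtype]
    exact hcnt (fun x => x * σ x)
  · rw [← hFF]
    exact Fintype.card_subtype_le _
  · rintro ⟨⟨a, b⟩, hl⟩ ⟨⟨a', b'⟩, hl'⟩ hne ⟨⟨x, y⟩, hp⟩ ⟨⟨x', y'⟩, hp'⟩ m1 m2 m3 m4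
    simp only [Finset.mem_filter, Finset.mem_univ, true_and] at m1 m2 m3 m4
    have hx : x = x' := by
      by_contra hxx
      apply hne
      have ha : (a - a') * (x - x') = 0 := by linear_combination m2 - m1 + m3 - m4
      have ha' : a = a' := by
        rcases mul_eq_zero.1 ha with h | h
        · exact sub_eq_zero.1 h
        · exact absurd (sub_eq_zero.1 h) hxx
      subst ha'
      have hb : b = b' := by linear_combination m2 - m1
      subst hb
      rfl
    subst hx
    have hy : y = y' := by rw [m1, m3]
    subst hy
    rfl
  · rintro ⟨⟨a1, b1⟩, hl1⟩ ⟨⟨a2, b2⟩, hl2⟩ ⟨⟨a3, b3⟩, hl3⟩ ⟨⟨a4, b4⟩, hl4⟩ ⟨⟨xA, yA⟩, hA⟩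
      ⟨⟨xB, yB⟩, hB⟩ ⟨⟨x1, y1⟩, h1⟩ ⟨⟨xC, yC⟩, hC⟩ ⟨⟨x2, y2⟩, h2'⟩ ⟨⟨x3, y3⟩, h3⟩
      m1 m2 m3 m4 m5 m6 m7 m8 m9 m10 m11 m12 n1 n2 n3 n4 n5
    simp only [Finset.mem_filter, Finset.mem_univ, true_and] at m1 m2 m3 m4 m5 m6 m7 m8 m9 m10 m11 m12 n1 n2 n3 n4 n5
    exact aux_onan σ xA yA xB yB xC yC x1 y1 x2 y2 x3 y3 a1 b1 a2 b2 a3 b3 a4 b4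
      hA hB hC h1 h2' h3 m1 m2 m3 m4 m7 m8 m5 m6 m9 m10 m11 m12 n1 n2 n3 n4 n5
  · rw [Fintype.card_subtype, ← hFF, ← Finset.card_univ (α := F × F),
      ← Finset.card_filter_add_card_filter_not (s := (Finset.univ : Finset (F × F)))
        (fun z : F × F => z.2 + σ z.2 + z.1 * σ z.1 ≠ 0)]
    apply Nat.add_le_add_left
    refine le_trans (Finset.card_le_card ?_) (hcnt (fun x => -(x * σ x)))
    intro z hz
    simp only [Finset.mem_filter, Finset.mem_univ, true_and, not_not, ne_eq] at hz ⊢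
    linear_combination hz

lemma aux_ram0 {W : Type} [Fintype W] (H : SimpleGraph W) (t n N : ℕ) (htn : t ≤ n)
    (hK : ∀ a b c d, H.Adj a b → H.Adj a c → H.Adj a d → H.Adj b c → H.Adj b d → H.Adj c d → False)
    (hI : ∀ T : Finset W, T.card = t → ¬ H.IsIndependent T)
    (hmem : ∀ G : SimpleGraph (Fin N),
    (∃ X : Finset (Fin N), X.card = 4 ∧ Gᶜ.IsIndependent X) ∨
    (∃ X : Finset (Fin N), X.card = n ∧ G.IsIndependent X)) : Fintype.card W < N := by
  by_contra hlt
  push Not at hlt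
  obtain ⟨f⟩ : Nonempty (Fin N ↪ W) := by
    apply Function.Embedding.nonempty_of_card_le
    rwa [Fintype.card_fin]
  rcases hmem (H.comap f) with ⟨X, hX, hX'⟩ | ⟨X, hX, hX'⟩
  · let e := (X.equivFinOfCardEq hX).symm
    have key : ∀ i k : Fin 4, i ≠ k → H.Adj (f (e i)) (f (e k)) := by
      intro i k hik
      have h1 := hX' (e i) (e i).2 (e k) (e k).2
      have h2 : (e i : Fin N) ≠ e k := fun h => hik (e.injective (Subtype.ext h))
      rw [SimpleGraph.compl_adj] at h1
      push Not at h1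
      exact h1 h2
    exact hK _ _ _ _ (key 0 1 (by decide)) (key 0 2 (by decide)) (key 0 3 (by decide))
      (key 1 2 (by decide)) (key 1 3 (by decide)) (key 2 3 (by decide))
  · obtain ⟨T, hT, hTc⟩ := Finset.exists_subset_card_eq (s := X) (n := t) (by omega)
    apply hI (T.map f) (by rw [Finset.card_map, hTc])
    intro x hx y hy
    rw [Finset.mem_map] at hx hy
    obtain ⟨x, hx, rfl⟩ := hx
    obtain ⟨y, hy, rfl⟩ := hy
    exact hX' x (hT hx) y (hT hy)

lemma aux_ram {W : Type} [Fintype W] (H : SimpleGraph W) (t n : ℕ) (htn : t ≤ n)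
    (hK : ∀ a b c d, H.Adj a b → H.Adj a c → H.Adj a d → H.Adj b c → H.Adj b d → H.Adj c d → False)
    (hI : ∀ T : Finset W, T.card = t → ¬ H.IsIndependent T) :
    ramsey 4 n = 0 ∨ Fintype.card W < ramsey 4 n := by
  by_cases hne : {N : ℕ | ∀ G : SimpleGraph (Fin N),
    (∃ X : Finset (Fin N), X.card = 4 ∧ Gᶜ.IsIndependent X) ∨
    (∃ X : Finset (Fin N), X.card = n ∧ G.IsIndependent X)}.Nonempty
  · right
    exact aux_ram0 H t n _ htn hK hI (Nat.sInf_mem hne)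
  · left
    rw [Set.not_nonempty_iff_eq_empty] at hne
    rw [ramsey, hne, Nat.sInf_empty]

lemma aux_r4 (j n : ℕ) (hj : 8 ≤ j) (h1 : 2000 * 2 ^ j * j ^ 2 ≤ n) :
    ramsey 4 n = 0 ∨ (2 ^ j) ^ 3 ≤ 2 * ramsey 4 n := by
  have hjq : 20 * j < 2 ^ j := by
    induction j, hj using Nat.le_induction with
    | base => norm_num
    | succ k hk ih =>
      have := ih (le_trans (by gcongr <;> omega) h1)
      rw [pow_succ]
      omega
  obtain ⟨P, L, iP, iL, inc, a1, a2, a3, a4, a5, a6⟩ := aux_unital j (2 ^ j) rfl (by omega)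
  obtain ⟨W, H, b1, b2, b3⟩ := aux_lower inc j (2 ^ j) rfl hjq (by omega) a1 a2 a3 a4 a5
  rcases aux_ram H _ n h1 b1 b2 with h | h
  · exact Or.inl h
  · right
    rw [Fintype.card_coe] at h
    have hq : 2 ≤ 2 ^ j := by omega
    set q := 2 ^ j
    have c1 : q * q ^ 3 ≤ q * (W.card + q ^ 2) := by
      calc q * q ^ 3 = q ^ 4 := by ring
        _ ≤ Fintype.card L + q ^ 3 := a6
        _ ≤ q * W.card + q ^ 3 := by omega
        _ = _ := by ring
    have c2 := Nat.le_of_mul_le_mul_left c1 (by omega)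
    have c3 : 2 * q ^ 2 ≤ q ^ 3 := by rw [pow_succ q 2, mul_comm]; gcongr
    omega

lemma aux_up (j n : ℕ) (hj : 8 ≤ j) (h1 : 2000 * 2 ^ j * j ^ 2 ≤ n)
    (h2 : n < 2000 * 2 ^ (j + 1) * (j + 1) ^ 2) :
    (mixedRamsey 4 n : ℝ) ≤ 106 * j * (127 * (√2) ^ j * j) * (16000 * 2 ^ j * j ^ 2) ^ 2 := by
  have hn1 : 1 ≤ n := by
    refine le_trans ?_ h1
    have : 0 < 2000 * 2 ^ j * j ^ 2 := by positivity
    exact this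
  have hn : n < 16000 * 2 ^ j * j ^ 2 := by
    refine h2.trans_le ?_
    calc 2000 * 2 ^ (j + 1) * (j + 1) ^ 2 ≤ 2000 * 2 ^ (j + 1) * (2 * j) ^ 2 := by gcongr; omega
      _ = _ := by ring
  have hlog : Nat.log 2 n + 1 ≤ 17 * j := by
    have : Nat.log 2 n < 14 + 3 * j := by
      apply Nat.log_lt_of_lt_pow (by omega)
      calc n < 16000 * 2 ^ j * j ^ 2 := hn
        _ ≤ 2 ^ 14 * 2 ^ j * (2 ^ j) ^ 2 := by
          gcongr
          · norm_num
          · exact Nat.lt_two_pow_self.le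
        _ = _ := by ring
    omega
  have h := aux_t4 n hn1
  have hR : (mixedRamsey 4 n : ℝ) ≤ ((auxK n : ℝ) * n + 1) * n := by exact_mod_cast h
  refine hR.trans ?_
  have hnR : (n : ℝ) ≤ 16000 * 2 ^ j * j ^ 2 := by exact_mod_cast hn.le
  have hn1R : (1 : ℝ) ≤ n := by exact_mod_cast hn1
  have hjR : (8 : ℝ) ≤ j := by exact_mod_cast hj
  set r := √(n : ℝ) with hr
  have hr1 : 1 ≤ r := by rw [hr]; exact Real.one_le_sqrt.2 hn1R
  have hrs : (Nat.sqrt n : ℝ) ≤ r := Real.nat_sqrt_le_real_sqrt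
  have hr2 : r ≤ 127 * (√2) ^ j * j := by
    rw [hr]
    apply Real.sqrt_le_iff.2
    refine ⟨by positivity, hnR.trans ?_⟩
    have e : (127 * (√2 : ℝ) ^ j * j) ^ 2 = 127 ^ 2 * 2 ^ j * j ^ 2 := by
      rw [mul_pow, mul_pow, ← pow_mul, mul_comm j 2, pow_mul, Real.sq_sqrt (by norm_num)]
    rw [e]
    gcongr
    norm_num
  have hlogR : (Nat.log 2 n : ℝ) + 1 ≤ 17 * j := by exact_mod_cast hlog
  have hK : (auxK n : ℝ) ≤ 105 * j * r := by
    rw [auxK]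
    push_cast
    have : 3 * ((Nat.log 2 n : ℝ) + 1) * ((Nat.sqrt n : ℝ) + 1) ≤ 3 * (17 * j) * (2 * r) := by
      gcongr
      linarith
    nlinarith
  calc ((auxK n : ℝ) * n + 1) * n ≤ (105 * j * r * n + 1 * 1 * 1) * n := by
        rw [one_mul, one_mul]; gcongr
    _ ≤ (105 * j * r * n + j * r * n) * n := by gcongr; linarith
    _ = 106 * j * r * n ^ 2 := by ring
    _ ≤ _ := by gcongr

lemma aux_ratio (j n : ℕ) (hj : 8 ≤ j) (h1 : 2000 * 2 ^ j * j ^ 2 ≤ n)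
    (h2 : n < 2000 * 2 ^ (j + 1) * (j + 1) ^ 2) :
    (mixedRamsey 4 n : ℝ) / (ramsey 4 n : ℝ) ≤
      (2 * 106 * 127 * 16000 ^ 2) * ((j : ℝ) ^ 6 / (√2) ^ j) := by
  rcases aux_r4 j n hj h1 with h | h
  · rw [h]
    simp only [Nat.cast_zero, div_zero]
    positivity
  have hu := aux_up j n hj h1 h2
  have hR : ((2 : ℝ) ^ j) ^ 3 / 2 ≤ ramsey 4 n := by
    rw [div_le_iff₀ (by norm_num), mul_comm]
    exact_mod_cast h
  have e : (2 : ℝ) ^ j = ((√2) ^ j) ^ 2 := by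
    rw [← pow_mul, mul_comm j 2, pow_mul, Real.sq_sqrt (by norm_num)]
  have hy : (0 : ℝ) < (√2) ^ j := by positivity
  calc (mixedRamsey 4 n : ℝ) / (ramsey 4 n : ℝ)
      ≤ (106 * j * (127 * (√2) ^ j * j) * (16000 * 2 ^ j * j ^ 2) ^ 2) / (((2 : ℝ) ^ j) ^ 3 / 2) := by
        gcongr
    _ = _ := by
        rw [e]
        field_simp
        try ring

theorem t4_over_r4_tendsto_zero :
    Filter.Tendsto (fun n : ℕ => (mixedRamsey 4 n : ℝ) / (ramsey 4 n : ℝ))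
      Filter.atTop (nhds 0) := by
  classical
  set J : ℕ → ℕ := fun n => Nat.findGreatest (fun j => 2000 * 2 ^ j * j ^ 2 ≤ n) n with hJ
  have hJt : Filter.Tendsto J Filter.atTop Filter.atTop := by
    rw [Filter.tendsto_atTop]
    intro b
    filter_upwards [Filter.eventually_ge_atTop (max b (2000 * 2 ^ b * b ^ 2))] with n hn
    exact Nat.le_findGreatest (le_trans (le_max_left _ _) hn) (le_trans (le_max_right _ _) hn)
  have hs2 : (1 : ℝ) < √2 := by
    rw [Real.lt_sqrt (by norm_num)]; norm_num
  have hlim := ((tendsto_pow_const_div_const_pow_of_one_lt 6 hs2).const_mul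
    (2 * 106 * 127 * 16000 ^ 2)).comp hJt
  rw [mul_zero] at hlim
  refine squeeze_zero' (Filter.Eventually.of_forall (fun n => by positivity)) ?_ hlim
  filter_upwards [hJt.eventually_ge_atTop 8] with n hn
  apply aux_ratio (J n) n hn
  · exact Nat.findGreatest_spec (P := fun j => 2000 * 2 ^ j * j ^ 2 ≤ n) (Nat.zero_le n) (by simp)
  · by_cases h : J n + 1 ≤ n
    · have := Nat.findGreatest_is_greatest (P := fun j => 2000 * 2 ^ j * j ^ 2 ≤ n)
        (Nat.lt_succ_self (J n)) h
      exact not_le.1 this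
    · have h3 : 0 < 2000 * 2 ^ (J n + 1) * (J n + 1) := by positivity
      calc n < J n + 1 := by omega
        _ ≤ (2000 * 2 ^ (J n + 1) * (J n + 1)) * (J n + 1) := Nat.le_mul_of_pos_left _ h3
        _ = _ := by ring
end
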